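/- arXiv:1609.09487 — 10 statements merged into one kernel-verified Lean document; each statement's English description precedes it below -/
import Mathlib

section
/- Let X, Y, Z be nonempty finite sets and P(YZ|X) a classical channel satisfying P(y,z|x) = P(Y|X)(y|x)·P(Z|X)(z|x) for all x, y, z. Then there exist nonempty finite sets Λ_Y, Λ_Z, probability distributions p_Y on Λ_Y and p_Z on Λ_Z, and functions f_Y : Λ_Y × X → Y, f_Z : Λ_Z × X → Z such that for all x, y, z: P(y,z|x) = Σ_{λ_Y,λ_Z} [y = f_Y(λ_Y,x)]·[z = f_Z(λ_Z,x)]·p_Y(λ_Y)·p_Z(λ_Z), where [Q] denotes 1 if Q holds and 0 otherwise. (Theorem 1, direction 2 ⇒ 1.) -/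
open BigOperators

/-- A classical common-cause dilation of a channel `P(YZ|X)`: independent latent variables
`Λ_Y`, `Λ_Z` with distributions `p_Y`, `p_Z` and deterministic functions `f_Y`, `f_Z`
reproducing the channel. -/
structure ClassicalCommonCauseDilation (X Y Z : Type*)
    [DecidableEq Y] [DecidableEq Z] (P : X → Y → Z → ℝ) where
  ΛY : Type
  ΛZ : Type
  [fintΛY : Fintype ΛY]
  [fintΛZ : Fintype ΛZ]
  [nonemptyΛY : Nonempty ΛY]
  [nonemptyΛZ : Nonempty ΛZ]
  pY : ΛY → ℝ
  pZ : ΛZ → ℝ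
  pY_nonneg : ∀ l, 0 ≤ pY l
  pY_sum : ∑ l : ΛY, pY l = 1
  pZ_nonneg : ∀ l, 0 ≤ pZ l
  pZ_sum : ∑ l : ΛZ, pZ l = 1
  fY : ΛY × X → Y
  fZ : ΛZ × X → Z
  eq : ∀ x y z, P x y z = ∑ lY : ΛY, ∑ lZ : ΛZ,
    (if y = fY (lY, x) then 1 else 0) * (if z = fZ (lZ, x) then 1 else 0) * pY lY * pZ lZ

/-- Under a product of probability weights, each coordinate has the prescribed marginal. -/
theorem sum_pi_ite_mul_prod {ι κ : Type*} [Fintype ι] [DecidableEq ι] [Fintype κ] [DecidableEq κ]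
    (q : ι → κ → ℝ) (hq : ∀ i, ∑ k, q i k = 1) (i : ι) (k : κ) :
    ∑ g : ι → κ, (if k = g i then 1 else 0) * ∏ j, q j (g j) = q i k := by
  have h : ∀ g : ι → κ, (if k = g i then 1 else 0) * ∏ j, q j (g j) =
      ∏ j, (if j = i then if k = g j then 1 else 0 else 1) * q j (g j) := by
    intro g
    rw [Finset.prod_mul_distrib, Finset.prod_ite_eq' Finset.univ i]
    simp
  simp_rw [h]
  rw [← Fintype.prod_sum fun j k' => (if j = i then if k = k' then 1 else 0 else 1) * q j k',
    Fintype.prod_eq_single i fun j hj => by simp [hj, hq]]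
  simp

/-- A finite channel is a deterministic function of its input and an independent latent variable. -/
theorem exists_deterministic_latent {X Y : Type*} [Fintype X] [Fintype Y] [Nonempty Y]
    [DecidableEq Y] (Q : X → Y → ℝ) (hQ0 : ∀ x y, 0 ≤ Q x y) (hQ1 : ∀ x, ∑ y, Q x y = 1) :
    ∃ (Λ : Type) (_ : Fintype Λ) (_ : Nonempty Λ) (p : Λ → ℝ) (f : Λ × X → Y),
      (∀ l, 0 ≤ p l) ∧ ∑ l, p l = 1 ∧
        ∀ x y, Q x y = ∑ l, (if y = f (l, x) then 1 else 0) * p l := by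
  let eX := Fintype.equivFin X
  let eY := Fintype.equivFin Y
  let q : Fin (Fintype.card X) → Fin (Fintype.card Y) → ℝ := fun i k => Q (eX.symm i) (eY.symm k)
  have hq : ∀ i, ∑ k, q i k = 1 := fun i => by
    rw [← hQ1 (eX.symm i)]
    exact eY.symm.sum_comp fun y => Q (eX.symm i) y
  have : Nonempty (Fin (Fintype.card Y)) := eY.symm.nonempty
  refine ⟨Fin (Fintype.card X) → Fin (Fintype.card Y), inferInstance, inferInstance,
    fun g => ∏ i, q i (g i), fun a => eY.symm (a.1 (eX a.2)),
    fun g => Finset.prod_nonneg fun i _ => hQ0 _ _, ?_, fun x y => ?_⟩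
  · rw [← Fintype.prod_sum]
    simp [hq]
  · have h := sum_pi_ite_mul_prod q hq (eX x) (eY y)
    simp only [q, Equiv.symm_apply_apply] at h
    simp only [q, Equiv.eq_symm_apply, h]

/-- Theorem 1, 2 ⇒ 1: a classical channel whose outputs are conditionally independent
given the input admits a common-cause dilation. -/
theorem conditional_independence_implies_classical_dilation
    {X Y Z : Type*}
    [Fintype X] [Fintype Y] [Fintype Z]
    [Nonempty X] [Nonempty Y] [Nonempty Z]
    [DecidableEq Y] [DecidableEq Z]
    (P : X → Y → Z → ℝ)
    (hP0 : ∀ x y z, 0 ≤ P x y z)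
    (hP1 : ∀ x, ∑ y : Y, ∑ z : Z, P x y z = 1)
    (hCI : ∀ x y z, P x y z = (∑ z' : Z, P x y z') * (∑ y' : Y, P x y' z)) :
    Nonempty (ClassicalCommonCauseDilation X Y Z P) := by
  obtain ⟨ΛY, _, _, pY, fY, hY0, hY1, hY⟩ :=
    exists_deterministic_latent (fun x y => ∑ z, P x y z)
      (fun x y => Finset.sum_nonneg fun z _ => hP0 x y z) hP1
  obtain ⟨ΛZ, _, _, pZ, fZ, hZ0, hZ1, hZ⟩ :=
    exists_deterministic_latent (fun x z => ∑ y, P x y z)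
      (fun x z => Finset.sum_nonneg fun y _ => hP0 x y z)
      (fun x => Finset.sum_comm.trans (hP1 x))
  refine ⟨{ ΛY, ΛZ, pY, pZ, fY, fZ, pY_nonneg := hY0, pY_sum := hY1, pZ_nonneg := hZ0,
            pZ_sum := hZ1, eq := fun x y z => ?_ }⟩
  rw [hCI, hY, hZ, Finset.sum_mul_sum]
  exact Finset.sum_congr rfl fun _ _ => Finset.sum_congr rfl fun _ _ => by ring
end

section
/- Let a DAG on n nodes with finite node sets X i be given, and let P be a joint distribution on Π i, X i that is compatible with the DAG (i.e. arises from independent latent variables and deterministic functions of parents and latents). Then P is Markov for the DAG: for all x, P(x) = Π_i P(x_i | x|Parents i), where the conditionals are computed from P with the convention that division by zero yields 0. (Theorem 5, direction 1 ⇒ 2.) -/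
open BigOperators

noncomputable section

/-- The marginal `P_S(u)` of a joint distribution `P`: the sum of `P(x)` over those `x`
whose restriction to `S` equals `u`. -/
def margOn {n : ℕ} (X : Fin n → Type*) [∀ i, Fintype (X i)] [∀ i, DecidableEq (X i)]
    (P : (∀ i, X i) → ℝ) (S : Finset (Fin n)) (u : ∀ j : {j // j ∈ S}, X j.1) : ℝ :=
  ∑ x : ∀ i, X i, if ∀ j : {j // j ∈ S}, x j.1 = u j then P x else 0

/-- The conditional `P(x_i | x|Parents i)`, computed from `P`, with the convention that
division by zero yields `0` (which is the convention of real division). -/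
def condOn {n : ℕ} (Parents : Fin n → Finset (Fin n)) (X : Fin n → Type*)
    [∀ i, Fintype (X i)] [∀ i, DecidableEq (X i)]
    (P : (∀ i, X i) → ℝ) (i : Fin n) (x : ∀ i, X i) : ℝ :=
  margOn X P (insert i (Parents i)) (fun j => x j.1) /
    margOn X P (Parents i) (fun j => x j.1)

/-- `P` is Markov for the DAG: it factorizes as the product of the conditionals of each
node given its parents. -/
def IsMarkov {n : ℕ} (Parents : Fin n → Finset (Fin n)) (X : Fin n → Type*)
    [∀ i, Fintype (X i)] [∀ i, DecidableEq (X i)]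
    (P : (∀ i, X i) → ℝ) : Prop :=
  ∀ x, P x = ∏ i : Fin n, condOn Parents X P i x

/-- `P` is compatible with the DAG: it arises from independent latent variables and
deterministic functions of parents and latents. -/
structure DAGCompatible {n : ℕ} (Parents : Fin n → Finset (Fin n)) (X : Fin n → Type*)
    [∀ i, Fintype (X i)] [∀ i, DecidableEq (X i)]
    (P : (∀ i, X i) → ℝ) where
  Λ : Fin n → Type
  [fintΛ : ∀ i, Fintype (Λ i)]
  [nonemptyΛ : ∀ i, Nonempty (Λ i)]
  p : ∀ i, Λ i → ℝ
  p_nonneg : ∀ i l, 0 ≤ p i l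
  p_sum : ∀ i, ∑ l : Λ i, p i l = 1
  f : ∀ i, Λ i → (∀ j : {j // j ∈ Parents i}, X j.1) → X i
  eq : ∀ x, P x = ∑ lam : ∀ i, Λ i,
    (∏ i : Fin n, if x i = f i (lam i) (fun j => x j.1) then 1 else 0) *
      (∏ i : Fin n, p i (lam i))

open Finset Function in
/-- Resampling one coordinate uniformly multiplies a total sum by the number of its values. -/
theorem sum_sum_update {ι : Type*} [Fintype ι] [DecidableEq ι] {X : ι → Type*}
    [∀ i, Fintype (X i)] (k : ι) (h : (∀ i, X i) → ℝ) :
    ∑ y : ∀ i, X i, ∑ b : X k, h (update y k b) = Fintype.card (X k) * ∑ y, h y := by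
  have hinv : Involutive
      (fun z : (∀ i, X i) × X k => (update z.1 k z.2, z.1 k)) := by
    rintro ⟨y, b⟩
    simp
  have key := Equiv.sum_comp hinv.toPerm (fun z : (∀ i, X i) × X k => h z.1)
  simp only [Involutive.coe_toPerm, Fintype.sum_prod_type, sum_const, card_univ,
    nsmul_eq_mul] at key
  rw [key, ← mul_sum]

open Finset Function in
theorem sum_eq_zero_of_sum_update_eq_zero {ι : Type*} [Fintype ι] [DecidableEq ι]
    {X : ι → Type*} [∀ i, Fintype (X i)] [∀ i, Nonempty (X i)] (k : ι)
    (h : (∀ i, X i) → ℝ) (H : ∑ y : ∀ i, X i, ∑ b : X k, h (update y k b) = 0) :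
    ∑ y, h y = 0 := by
  rw [sum_sum_update] at H
  exact (mul_eq_zero.1 H).resolve_left (Nat.cast_ne_zero.2 Fintype.card_ne_zero)

open Finset Function in
/-- If `ψ` depends only on the coordinates up to `i` and averages to zero under the kernel of
node `i`, then it averages to zero under the product of all kernels. -/
theorem sum_mul_prod_kernel_eq_zero {n : ℕ} {X : Fin n → Type*} [∀ i, Fintype (X i)]
    [∀ i, Nonempty (X i)] (q : Fin n → (∀ i, X i) → ℝ)
    (hq : ∀ j k y b, j < k → q j (update y k b) = q j y)
    (hq1 : ∀ j y, ∑ b, q j (update y j b) = 1) (i : Fin n) (ψ : (∀ i, X i) → ℝ)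
    (hψ : ∀ k y b, i < k → ψ (update y k b) = ψ y)
    (hψ0 : ∀ y, ∑ b, ψ (update y i b) * q i (update y i b) = 0) :
    ∑ y, ψ y * ∏ j, q j y = 0 := by
  have split (k : Fin n) (y : ∀ i, X i) :
      ∏ j with j.val < k.val + 1, q j y = q k y * ∏ j with j < k, q j y := by
    rw [← prod_insert (f := fun j => q j y) (by simp)]
    congr 1
    ext j
    simp only [mem_filter, mem_univ, true_and, mem_insert, Fin.ext_iff, Fin.lt_def]
    omega
  have indep (k : Fin n) (y : ∀ i, X i) (b : X k) :
      ∏ j with j < k, q j (update y k b) = ∏ j with j < k, q j y :=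
    prod_congr rfl fun j hj => hq j k y b (mem_filter.1 hj).2
  have main : ∀ m, i.val + 1 ≤ m → m ≤ n →
      ∑ y, ψ y * ∏ j with j.val < m, q j y = 0 := by
    intro m hm
    induction m, hm using Nat.le_induction with
    | base =>
      intro _
      refine sum_eq_zero_of_sum_update_eq_zero i _ (sum_eq_zero fun y _ => ?_)
      simp only [split, indep, ← mul_assoc, ← sum_mul, hψ0, zero_mul]
    | succ m hm ih =>
      intro hmn
      let k : Fin n := ⟨m, hmn⟩
      refine sum_eq_zero_of_sum_update_eq_zero k _ ?_
      rw [← ih (by omega)]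
      refine sum_congr rfl fun y _ => ?_
      have hk (z : ∀ i, X i) := split k z
      simp only [k] at hk
      simp only [hk]
      change ∑ b, ψ (update y k b) * (q k (update y k b) * ∏ j with j < k, q j (update y k b))
        = ψ y * ∏ j with j < k, q j y
      simp only [indep, hψ k y _ (Fin.lt_def.2 hm), ← mul_sum, ← sum_mul, hq1, one_mul]
  simpa using main n i.isLt le_rfl

open Finset Function in
/-- For a product of kernels along a DAG, the joint marginal of a node and its parents is the
kernel of the node times the marginal of the parents. -/
theorem margOn_insert_parents {n : ℕ} (Parents : Fin n → Finset (Fin n))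
    (hpar : ∀ i, ∀ j ∈ Parents i, j < i) (X : Fin n → Type*) [∀ i, Fintype (X i)]
    [∀ i, DecidableEq (X i)] [∀ i, Nonempty (X i)] (P : (∀ i, X i) → ℝ)
    (q : Fin n → (∀ i, X i) → ℝ)
    (hq : ∀ j y z, (∀ k ∈ insert j (Parents j), y k = z k) → q j y = q j z)
    (hq1 : ∀ j y, ∑ b, q j (update y j b) = 1) (hP : ∀ y, P y = ∏ j, q j y)
    (i : Fin n) (x : ∀ i, X i) :
    margOn X P (insert i (Parents i)) (fun j => x j.1) =
      q i x * margOn X P (Parents i) (fun j => x j.1) := by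
  let ψ : (∀ i, X i) → ℝ := fun y =>
    (if ∀ j ∈ Parents i, y j = x j then 1 else 0) * ((if y i = x i then 1 else 0) - q i x)
  have agree (y : ∀ i, X i) (b : X i) :
      (∀ j ∈ Parents i, update y i b j = x j) ↔ ∀ j ∈ Parents i, y j = x j :=
    forall₂_congr fun j hj => by rw [update_of_ne (hpar i j hj).ne]
  have h0 : ∑ y, ψ y * ∏ j, q j y = 0 := by
    refine sum_mul_prod_kernel_eq_zero q ?_ hq1 i ψ ?_ ?_
    · refine fun j k y b hjk => hq j _ _ fun l hl => update_of_ne ?_ _ _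
      rcases mem_insert.1 hl with rfl | hl
      · exact hjk.ne
      · exact ((hpar j l hl).trans hjk).ne
    · intro k y b hik
      have hagree : (∀ j ∈ Parents i, update y k b j = x j) ↔ ∀ j ∈ Parents i, y j = x j :=
        forall₂_congr fun j hj => by rw [update_of_ne ((hpar i j hj).trans hik).ne]
      simp only [ψ, hagree, update_of_ne hik.ne]
    · intro y
      simp only [ψ, agree, update_self]
      split_ifs with hy
      · simp only [one_mul, sub_mul, sum_sub_distrib, ← mul_sum, hq1, mul_one, ite_mul,
          zero_mul, sum_ite_eq', mem_univ, if_true]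
        refine sub_eq_zero.2 (hq i _ _ fun k hk => ?_)
        rcases mem_insert.1 hk with rfl | hk
        · simp
        · rw [update_of_ne (hpar i k hk).ne, hy k hk]
      · simp
  rw [← sub_eq_zero, ← h0]
  simp only [margOn, mul_sum, ← sum_sub_distrib]
  refine sum_congr rfl fun y _ => ?_
  simp only [ψ, ← hP, Subtype.forall, forall_mem_insert]
  split_ifs <;> first | ring1 | tauto

open Finset Function in
/-- Theorem 5, 1 ⇒ 2: a joint distribution compatible with a DAG is Markov for it. -/
theorem compatible_implies_markov
    {n : ℕ} (Parents : Fin n → Finset (Fin n))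
    (hpar : ∀ i, ∀ j ∈ Parents i, j < i)
    (X : Fin n → Type*) [∀ i, Fintype (X i)] [∀ i, DecidableEq (X i)]
    [∀ i, Nonempty (X i)]
    (P : (∀ i, X i) → ℝ)
    (hP0 : ∀ x, 0 ≤ P x) (hP1 : ∑ x : ∀ i, X i, P x = 1)
    (hc : DAGCompatible Parents X P) :
    IsMarkov Parents X P := by
  obtain ⟨Λ, p, -, hp1, f, hP⟩ := hc
  let q : Fin n → (∀ i, X i) → ℝ := fun i y =>
    ∑ l, (if y i = f i l (fun j => y j.1) then 1 else 0) * p i l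
  have hPq (y : ∀ i, X i) : P y = ∏ i, q i y := by
    simp only [hP, q, ← prod_mul_distrib]
    rw [prod_univ_sum, Fintype.piFinset_univ]
  have hq (j : Fin n) (y z : ∀ i, X i) (h : ∀ k ∈ insert j (Parents j), y k = z k) :
      q j y = q j z := by
    have hpa : (fun k : {k // k ∈ Parents j} => y k.1) = fun k : {k // k ∈ Parents j} => z k.1 :=
      funext fun k => h k.1 (mem_insert_of_mem k.2)
    simp only [q, hpa, h j (mem_insert_self _ _)]
  have hq1 (j : Fin n) (y : ∀ i, X i) : ∑ b, q j (update y j b) = 1 := by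
    have hpa (b : X j) : (fun k : {k // k ∈ Parents j} => update y j b k.1) =
        fun k : {k // k ∈ Parents j} => y k.1 :=
      funext fun k => update_of_ne (hpar j k.1 k.2).ne _ _
    simp only [q, hpa, update_self]
    rw [sum_comm]
    simp [hp1]
  have hmarg := margOn_insert_parents Parents hpar X P q hq hq1 hPq
  intro x
  by_cases h : ∃ i, margOn X P (Parents i) (fun j => x j.1) = 0
  · obtain ⟨i, hi⟩ := h
    rw [prod_eq_zero (mem_univ i) (by rw [condOn, hi, div_zero])]
    have hx := (sum_eq_zero_iff_of_nonneg fun y _ => by split_ifs <;> simp [hP0]).1 hi x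
      (mem_univ x)
    simpa using hx
  · push Not at h
    rw [hPq]
    refine prod_congr rfl fun i _ => ?_
    rw [condOn, hmarg, mul_div_cancel_right₀ _ (h i)]

end
end

section
/- Let a DAG on n nodes with finite node sets X i be given, and let P be a joint distribution on Π i, X i that is Markov for the DAG, i.e. P(x) = Π_i P(x_i | x|Parents i) for all x (conditionals computed from P, with division by zero yielding 0). Then P is compatible with the DAG: there exist nonempty finite sets Λ i, probability distributions p_i on Λ i, and functions f_i : Λ i × (Π_{j ∈ Parents i} X j) → X i such that for all x, P(x) = Σ_{λ} (Π_i [x_i = f_i(λ_i, x|Parents i)]) · (Π_i p_i(λ_i)). (Theorem 5, direction 2 ⇒ 1.) -/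
open BigOperators

noncomputable section

/-- A stochastic kernel between finite types is a mixture of deterministic functions. -/
theorem exists_mixture_of_kernel {A B : Type*} [Fintype A] [Fintype B] [DecidableEq B]
    (K : A → B → ℝ) (hK0 : ∀ a b, 0 ≤ K a b) (hK1 : ∀ a, ∑ b, K a b = 1) :
    ∃ (m : ℕ) (p : Fin m → ℝ) (f : Fin m → A → B), (∀ l, 0 ≤ p l) ∧ ∑ l, p l = 1 ∧
      ∀ a b, K a b = ∑ l, (if b = f l a then 1 else 0) * p l := by
  classical
  let e := (Fintype.equivFin (A → B)).symm
  refine ⟨Fintype.card (A → B), fun l => ∏ a, K a (e l a), fun l => e l,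
    fun l => Finset.prod_nonneg fun a _ => hK0 _ _, ?_, fun a₀ b => ?_⟩
  · rw [e.sum_comp fun g : A → B => ∏ a, K a (g a), ← Fintype.prod_sum]
    simp [hK1]
  · rw [e.sum_comp fun g : A → B => (if b = g a₀ then (1 : ℝ) else 0) * ∏ a, K a (g a)]
    have key : ∀ g : A → B, (if b = g a₀ then (1 : ℝ) else 0) * ∏ a, K a (g a) =
        ∏ a, (if a = a₀ then (if b = g a then (1 : ℝ) else 0) else 1) * K a (g a) := by
      intro g
      rw [Finset.prod_mul_distrib]
      simp
    simp_rw [key]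
    rw [← Fintype.prod_sum
      fun a b' => (if a = a₀ then (if b = b' then (1 : ℝ) else 0) else 1) * K a b',
      Finset.prod_eq_single a₀]
    · simp
    · intro a _ ha
      simp [ha, hK1]
    · simp

/-- A system of equations in which each node is determined by its parents has a unique
solution. -/
theorem existsUnique_structural_solution {n : ℕ} {Parents : Fin n → Finset (Fin n)}
    (hpar : ∀ i, ∀ j ∈ Parents i, j < i) {X : Fin n → Type*}
    (g : ∀ i, (∀ j : {j // j ∈ Parents i}, X j.1) → X i) :
    ∃! x : ∀ i, X i, ∀ i, x i = g i (fun j => x j.1) := by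
  have wf : WellFounded ((· < ·) : Fin n → Fin n → Prop) := wellFounded_lt
  refine ⟨wf.fix fun i x => g i fun j => x j.1 (hpar i j.1 j.2),
    fun i => wf.fix_eq _ i, fun y hy => funext fun i => ?_⟩
  induction i using wf.induction with
  | _ i ih =>
    rw [hy i, wf.fix_eq]
    exact congrArg (g i) (funext fun j => ih j.1 (hpar i j.1 j.2))

/-- The probabilities of the outcomes generated by a functional model sum to one. -/
theorem sum_functional_model {n : ℕ} {Parents : Fin n → Finset (Fin n)}
    (hpar : ∀ i, ∀ j ∈ Parents i, j < i) {X : Fin n → Type*}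
    [∀ i, Fintype (X i)] [∀ i, DecidableEq (X i)]
    {Λ : Fin n → Type*} [∀ i, Fintype (Λ i)] (p : ∀ i, Λ i → ℝ) (hp : ∀ i, ∑ l, p i l = 1)
    (f : ∀ i, Λ i → (∀ j : {j // j ∈ Parents i}, X j.1) → X i) :
    ∑ x : ∀ i, X i, ∑ lam : ∀ i, Λ i,
      (∏ i, if x i = f i (lam i) (fun j => x j.1) then (1 : ℝ) else 0) *
        ∏ i, p i (lam i) = 1 := by
  rw [Finset.sum_comm]
  have key : ∀ lam : ∀ i, Λ i, ∑ x : ∀ i, X i,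
      (∏ i, if x i = f i (lam i) (fun j => x j.1) then (1 : ℝ) else 0) = 1 := by
    intro lam
    obtain ⟨y, hy, huniq⟩ := existsUnique_structural_solution hpar fun i => f i (lam i)
    rw [Finset.sum_eq_single y]
    · exact Finset.prod_eq_one fun i _ => if_pos (hy i)
    · intro x _ hx
      obtain ⟨i, hi⟩ := not_forall.1 fun h => hx (huniq x h)
      exact Finset.prod_eq_zero (Finset.mem_univ i) (if_neg hi)
    · simp
  simp_rw [← Finset.sum_mul, key, one_mul]
  rw [← Fintype.prod_sum]
  simp [hp]

theorem margOn_nonneg {n : ℕ} {X : Fin n → Type*} [∀ i, Fintype (X i)]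
    [∀ i, DecidableEq (X i)] {P : (∀ i, X i) → ℝ} (hP : ∀ x, 0 ≤ P x)
    (S : Finset (Fin n)) (u : ∀ j : {j // j ∈ S}, X j.1) : 0 ≤ margOn X P S u :=
  Finset.sum_nonneg fun x _ => by split_ifs <;> simp [hP x]

/-- The conditionals of a distribution are dominated by stochastic kernels, which take an
arbitrary value where the conditioning event is null. -/
theorem exists_kernel_ge_condOn {n : ℕ} (Parents : Fin n → Finset (Fin n))
    {X : Fin n → Type*} [∀ i, Fintype (X i)] [∀ i, DecidableEq (X i)] [∀ i, Nonempty (X i)]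
    {P : (∀ i, X i) → ℝ} (hP : ∀ x, 0 ≤ P x) (i : Fin n) :
    ∃ K : (∀ j : {j // j ∈ Parents i}, X j.1) → X i → ℝ,
      (∀ u b, 0 ≤ K u b) ∧ (∀ u, ∑ b, K u b = 1) ∧
      ∀ x, condOn Parents X P i x ≤ K (fun j => x j.1) (x i) := by
  let N (u : ∀ j : {j // j ∈ Parents i}, X j.1) (b : X i) : ℝ :=
    ∑ x : ∀ i, X i, if x i = b ∧ ∀ j : {j // j ∈ Parents i}, x j.1 = u j then P x else 0
  have hN0 : ∀ u b, 0 ≤ N u b := fun u b =>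
    Finset.sum_nonneg fun x _ => by split_ifs <;> simp [hP x]
  have hN : ∀ u, ∑ b, N u b = margOn X P (Parents i) u := by
    intro u
    simp only [N, margOn]
    rw [Finset.sum_comm]
    simp [ite_and]
  have hNx : ∀ x : ∀ i, X i, margOn X P (insert i (Parents i)) (fun j => x j.1) =
      N (fun j => x j.1) (x i) := by
    intro x
    simp [N, margOn]
  refine ⟨fun u b => if margOn X P (Parents i) u = 0 then
    (if b = Classical.arbitrary (X i) then 1 else 0) else N u b / margOn X P (Parents i) u,
    fun u b => ?_, fun u => ?_, fun x => ?_⟩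
  · dsimp only
    split_ifs
    · exact zero_le_one
    · exact le_rfl
    · exact div_nonneg (hN0 u b) (margOn_nonneg hP _ _)
  · by_cases h : margOn X P (Parents i) u = 0
    · simp [h]
    · simp only [h, if_false]
      rw [← Finset.sum_div, hN, div_self h]
  · rw [condOn, hNx]
    dsimp only
    split_ifs with h h' <;> simp [h]

/-- Theorem 5, 2 ⇒ 1: a joint distribution that is Markov for a DAG is compatible with
it. -/
theorem markov_implies_compatible
    {n : ℕ} (Parents : Fin n → Finset (Fin n))
    (hpar : ∀ i, ∀ j ∈ Parents i, j < i)
    (X : Fin n → Type*) [∀ i, Fintype (X i)] [∀ i, DecidableEq (X i)]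
    [∀ i, Nonempty (X i)]
    (P : (∀ i, X i) → ℝ)
    (hP0 : ∀ x, 0 ≤ P x) (hP1 : ∑ x : ∀ i, X i, P x = 1)
    (hm : IsMarkov Parents X P) :
    Nonempty (DAGCompatible Parents X P) := by
  choose K hK0 hK1 hKge using exists_kernel_ge_condOn Parents hP0
  choose m p f hp0 hp1 hpf using fun i => exists_mixture_of_kernel (K i) (hK0 i) (hK1 i)
  have hprod : ∀ x : ∀ i, X i, ∏ i, K i (fun j => x j.1) (x i) =
      ∑ lam : ∀ i, Fin (m i),
        (∏ i, if x i = f i (lam i) (fun j => x j.1) then (1 : ℝ) else 0) *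
          ∏ i, p i (lam i) := by
    intro x
    simp_rw [hpf, Fintype.prod_sum, Finset.prod_mul_distrib]
  have hle : ∀ x ∈ Finset.univ, P x ≤ ∏ i, K i (fun j => x j.1) (x i) := by
    intro x _
    rw [hm x]
    exact Finset.prod_le_prod
      (fun i _ => div_nonneg (margOn_nonneg hP0 _ _) (margOn_nonneg hP0 _ _))
      fun i _ => hKge i x
  have hsum : ∑ x, P x = ∑ x : ∀ i, X i, ∏ i, K i (fun j => x j.1) (x i) := by
    simp_rw [hprod]
    rw [hP1, sum_functional_model hpar p hp1 f]
  have hne : ∀ i, Nonempty (Fin (m i)) := by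
    intro i
    by_contra h
    have := not_nonempty_iff.1 h
    simpa using hp1 i
  exact ⟨{
    Λ := fun i => Fin (m i)
    p := p
    p_nonneg := hp0
    p_sum := hp1
    f := f
    eq := fun x => ((Finset.sum_eq_sum_iff_of_le hle).1 hsum x (Finset.mem_univ x)).trans
      (hprod x) }⟩

end
end

section
/- Let ρ_{BC|A} be the CJ channel operator induced by a common-cause dilation (a unitary U from inputs λB × a × λC to outputs b × d × c, together with density matrices ρ_{λB}, ρ_{λC}, such that λB has no causal influence on C and λC has no causal influence on B). Then ρ_{BC|A} = ↑ρ_{B|A} · ↑ρ_{C|A}, the product of its extended marginals. (Theorem 2, direction 1 ⇒ 2.) -/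
open Matrix BigOperators
open scoped ComplexOrder

noncomputable section

/-- Partial trace over the first tensor factor. -/
def ptrace₁ {α β : Type*} [Fintype α] (M : Matrix (α × β) (α × β) ℂ) : Matrix β β ℂ :=
  Matrix.of fun j j' => ∑ i, M (i, j) (i, j')

/-- Partial trace over the second tensor factor. -/
def ptrace₂ {α β : Type*} [Fintype β] (M : Matrix (α × β) (α × β) ℂ) : Matrix α α ℂ :=
  Matrix.of fun i i' => ∑ j, M (i, j) (i', j)

/-- `M` is a Choi–Jamiołkowski channel operator from `a` to `b`: positive semidefinite with
partial trace over the output equal to the identity. -/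
def IsCJChannel {b a : Type*} [Fintype b] [Fintype a] [DecidableEq a]
    (M : Matrix (b × a) (b × a) ℂ) : Prop :=
  M.PosSemidef ∧ ptrace₁ M = 1

/-- The marginal `ρ_{B|A}` of a channel operator `ρ_{BC|A}` (partial trace over `C`). -/
def margB {b c a : Type*} [Fintype c] (ρ : Matrix ((b × c) × a) ((b × c) × a) ℂ) :
    Matrix (b × a) (b × a) ℂ :=
  Matrix.of fun p q => ∑ γ, ρ ((p.1, γ), p.2) ((q.1, γ), q.2)

/-- The marginal `ρ_{C|A}` of a channel operator `ρ_{BC|A}` (partial trace over `B`). -/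
def margC {b c a : Type*} [Fintype b] (ρ : Matrix ((b × c) × a) ((b × c) × a) ℂ) :
    Matrix (c × a) (c × a) ℂ :=
  Matrix.of fun p q => ∑ β, ρ ((β, p.1), p.2) ((β, q.1), q.2)

/-- Extension `↑ρ_{B|A}` of a marginal to the full space, tensoring with the identity on `C`. -/
def extB {b c a : Type*} [DecidableEq c] (M : Matrix (b × a) (b × a) ℂ) :
    Matrix ((b × c) × a) ((b × c) × a) ℂ :=
  Matrix.of fun p q => M (p.1.1, p.2) (q.1.1, q.2) * (if p.1.2 = q.1.2 then 1 else 0)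

/-- Extension `↑ρ_{C|A}` of a marginal to the full space, tensoring with the identity on `B`. -/
def extC {b c a : Type*} [DecidableEq b] (M : Matrix (c × a) (c × a) ℂ) :
    Matrix ((b × c) × a) ((b × c) × a) ℂ :=
  Matrix.of fun p q => M (p.1.2, p.2) (q.1.2, q.2) * (if p.1.1 = q.1.1 then 1 else 0)

/-- The Choi–Jamiołkowski operator of a (unitary) matrix `U`. -/
def cjOf {y x : Type*} (U : Matrix y x ℂ) : Matrix (y × x) (y × x) ℂ :=
  Matrix.of fun p q => U p.1 p.2 * star (U q.1 q.2)

/-- A (possibly rectangular-typed) matrix is unitary if both `U Uᴴ = 1` and `Uᴴ U = 1`. -/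
def IsUnitaryMat {y x : Type*} [Fintype y] [Fintype x] [DecidableEq y] [DecidableEq x]
    (U : Matrix y x ℂ) : Prop :=
  U * Uᴴ = 1 ∧ Uᴴ * U = 1

/-- von Neumann entropy of a matrix (junk value `0` if not Hermitian);
`Real.log 0 = 0` gives the usual convention `0 log 0 = 0`. -/
def vNEntropy {n : Type*} [Fintype n] (M : Matrix n n ℂ) : ℝ :=
  letI := Classical.decEq n
  if h : M.IsHermitian then -∑ i, h.eigenvalues i * Real.log (h.eigenvalues i) else 0

/-- Quantum conditional mutual information `I(B:C|A)` of a matrix on `(b × c) × a`,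
with systems grouped as `B`, `C`, `A`. -/
def qcmiBCA {b c a : Type*} [Fintype b] [Fintype c] [Fintype a]
    (ρ : Matrix ((b × c) × a) ((b × c) × a) ℂ) : ℝ :=
  vNEntropy (margB ρ) + vNEntropy (margC ρ) - vNEntropy ρ - vNEntropy (ptrace₁ ρ)

/-- Conjugation of `ρ` on its `A` indices by a matrix `V` from `a` to `σa`. -/
def conjOnA {o σa a : Type*} [Fintype a] (ρ : Matrix (o × a) (o × a) ℂ)
    (V : Matrix σa a ℂ) : Matrix (o × σa) (o × σa) ℂ :=
  Matrix.of fun p q => ∑ x : a, ∑ x' : a, V p.2 x * ρ (p.1, x) (q.1, x') * star (V q.2 x')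

section
variable {b c a : Type*} [Fintype b] [Fintype c] [Fintype a]
  [DecidableEq a] [DecidableEq b] [DecidableEq c]
  [Nonempty a] [Nonempty b] [Nonempty c]

/-- A common-cause dilation of a channel operator `ρ_{BC|A}`: a unitary `U` from
`λB × A × λC` to `B × D × C` together with input states on the ancillas, such that the
induced channel is `ρ`, `λB` has no causal influence on `C`, and `λC` has no causal
influence on `B`. -/
structure CommonCauseDilation (ρ : Matrix ((b × c) × a) ((b × c) × a) ℂ) where
  lamB : Type
  lamC : Type
  d : Type
  [fintlamB : Fintype lamB]
  [fintlamC : Fintype lamC]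
  [fintd : Fintype d]
  [nonemptylamB : Nonempty lamB]
  [nonemptylamC : Nonempty lamC]
  [nonemptyd : Nonempty d]
  [deceqlamB : DecidableEq lamB]
  [deceqlamC : DecidableEq lamC]
  [deceqd : DecidableEq d]
  card_eq : Fintype.card lamB * Fintype.card a * Fintype.card lamC =
      Fintype.card b * Fintype.card d * Fintype.card c
  U : Matrix (b × d × c) (lamB × a × lamC) ℂ
  hU : IsUnitaryMat U
  ρlamB : Matrix lamB lamB ℂ
  ρlamC : Matrix lamC lamC ℂ
  hρlamB : ρlamB.PosSemidef ∧ ρlamB.trace = 1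
  hρlamC : ρlamC.PosSemidef ∧ ρlamC.trace = 1
  induced : ∀ (β β' : b) (γ γ' : c) (i i' : a),
    ρ ((β, γ), i) ((β', γ'), i') =
      ∑ δ : d, ∑ l : lamB, ∑ l' : lamB, ∑ m : lamC, ∑ m' : lamC,
        U (β, δ, γ) (l, i, m) * ρlamB l l' * ρlamC m m' * star (U (β', δ, γ') (l', i', m'))
  no_influence_lamB_on_C : ∃ σ : Matrix (c × (a × lamC)) (c × (a × lamC)) ℂ,
    ∀ (γ γ' : c) (l l' : lamB) (i i' : a) (m m' : lamC),
      (∑ β : b, ∑ δ : d, cjOf U ((β, δ, γ), (l, i, m)) ((β, δ, γ'), (l', i', m'))) =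
        (if l = l' then 1 else 0) * σ (γ, (i, m)) (γ', (i', m'))
  no_influence_lamC_on_B : ∃ τ : Matrix (b × (lamB × a)) (b × (lamB × a)) ℂ,
    ∀ (β β' : b) (l l' : lamB) (i i' : a) (m m' : lamC),
      (∑ δ : d, ∑ γ : c, cjOf U ((β, δ, γ), (l, i, m)) ((β', δ, γ), (l', i', m'))) =
        (if m = m' then 1 else 0) * τ (β, (l, i)) (β', (l', i'))

/-- A unitary whose first input does not influence the last output, and whose last input does not
influence the first output, factorizes (after tracing out the middle output) through the
middle input. -/
lemma sum_mul_star_eq_sum_of_no_influence {b c a d lB lC : Type*}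
    [Fintype b] [Fintype c] [Fintype a] [Fintype d] [Fintype lB] [Fintype lC]
    [DecidableEq b] [DecidableEq c] [DecidableEq d] [DecidableEq lB] [DecidableEq lC]
    (U : Matrix (b × d × c) (lB × a × lC) ℂ) (hU : U * Uᴴ = 1)
    (σ : Matrix (c × (a × lC)) (c × (a × lC)) ℂ) (τ : Matrix (b × (lB × a)) (b × (lB × a)) ℂ)
    (hσ : ∀ (γ γ' : c) (l l' : lB) (i i' : a) (m m' : lC),
      (∑ β : b, ∑ δ : d, U (β, δ, γ) (l, i, m) * star (U (β, δ, γ') (l', i', m'))) =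
        (if l = l' then 1 else 0) * σ (γ, (i, m)) (γ', (i', m')))
    (hτ : ∀ (β β' : b) (l l' : lB) (i i' : a) (m m' : lC),
      (∑ δ : d, ∑ γ : c, U (β, δ, γ) (l, i, m) * star (U (β', δ, γ) (l', i', m'))) =
        (if m = m' then 1 else 0) * τ (β, (l, i)) (β', (l', i')))
    (β β' : b) (γ γ' : c) (l l' : lB) (i i' : a) (m m' : lC) :
    ∑ δ : d, U (β, δ, γ) (l, i, m) * star (U (β', δ, γ') (l', i', m')) =
      ∑ k : a, τ (β, (l, i)) (β', (l', k)) * σ (γ, (k, m)) (γ', (i', m')) := by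
  have hrow (p q : b × d × c) : ∑ x, U p x * star (U q x) = if p = q then 1 else 0 := by
    simpa [Matrix.mul_apply, Matrix.one_apply] using congrFun (congrFun hU p) q
  calc
    _ = ∑ δ₃ : d, ∑ γ₃ : c, ∑ β₂ : b, ∑ δ₂ : d,
        U (β, δ₃, γ₃) (l, i, m) * star (U (β₂, δ₂, γ') (l', i', m')) *
          ∑ x, U (β₂, δ₂, γ) x * star (U (β', δ₃, γ₃) x) := by
      simp only [hrow]
      simp [ite_and]
    _ = ∑ x : lB × a × lC,
        (∑ δ : d, ∑ γ : c, U (β, δ, γ) (l, i, m) * star (U (β', δ, γ) x)) *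
          ∑ β : b, ∑ δ : d, U (β, δ, γ) x * star (U (β, δ, γ') (l', i', m')) := by
      simp only [Finset.sum_mul, Finset.mul_sum]
      simp only [← Fintype.sum_prod_type']
      refine Finset.sum_nbij' (fun z => (z.2.2.2.2, z.2.2.1, z.2.2.2.1, z.1, z.2.1))
        (fun z => (z.2.2.2.1, z.2.2.2.2, z.2.1, z.2.2.1, z.1)) ?_ ?_ ?_ ?_ ?_ <;> simp
      intros
      ring
    _ = _ := by
      simp only [Fintype.sum_prod_type, hσ, hτ]
      simp

/-- Contracting the input state of a non-influencing ancilla gives a factor of its trace. -/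
lemma sum_mul_ite_eq_of_trace_eq_one {n : Type*} [Fintype n] [DecidableEq n]
    (M : Matrix n n ℂ) (hM : M.trace = 1) (z : ℂ) :
    ∑ m, ∑ m', M m m' * ((if m = m' then 1 else 0) * z) = z := by
  simp only [ite_mul, one_mul, zero_mul, mul_ite, mul_zero, Finset.sum_ite_eq, Finset.mem_univ,
    if_true, ← Finset.sum_mul]
  rw [show ∑ i, M i i = 1 from hM, one_mul]

/-- Theorem 2, 1 ⇒ 2: a channel compatible with `A` being the complete common cause of
`B` and `C` factorizes as the product of its extended marginals. -/
theorem dilation_implies_factorization (ρ : Matrix ((b × c) × a) ((b × c) × a) ℂ)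
    (hρ : IsCJChannel ρ) (D : CommonCauseDilation ρ) :
    ρ = extB (margB ρ) * extC (margC ρ) := by
  obtain ⟨lB, lC, d, -, U, ⟨hU, -⟩, ρB, ρC, ⟨-, hB⟩, ⟨-, hC⟩, ind, ⟨σ, hσ⟩, ⟨τ, hτ⟩⟩ := D
  simp only [cjOf, Matrix.of_apply] at hσ hτ
  have hmB (β β' : b) (i i' : a) : margB ρ (β, i) (β', i') =
      ∑ l, ∑ l', ρB l l' * τ (β, (l, i)) (β', (l', i')) := by
    calc
      _ = ∑ l, ∑ l', ρB l l' * ∑ m, ∑ m', ρC m m' *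
          ∑ δ, ∑ γ, U (β, δ, γ) (l, i, m) * star (U (β', δ, γ) (l', i', m')) := by
        simp only [margB, Matrix.of_apply, ind, Finset.mul_sum]
        simp only [← Fintype.sum_prod_type']
        refine Finset.sum_nbij' (fun z => (z.2.2.1, z.2.2.2.1, z.2.2.2.2.1, z.2.2.2.2.2, z.2.1, z.1))
          (fun z => (z.2.2.2.2.2, z.2.2.2.2.1, z.1, z.2.1, z.2.2.1, z.2.2.2.1))
          ?_ ?_ ?_ ?_ ?_ <;> simp
        intros
        ring
      _ = _ := by simp only [hτ, sum_mul_ite_eq_of_trace_eq_one ρC hC]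
  have hmC (γ γ' : c) (i i' : a) : margC ρ (γ, i) (γ', i') =
      ∑ m, ∑ m', ρC m m' * σ (γ, (i, m)) (γ', (i', m')) := by
    calc
      _ = ∑ m, ∑ m', ρC m m' * ∑ l, ∑ l', ρB l l' *
          ∑ β, ∑ δ, U (β, δ, γ) (l, i, m) * star (U (β, δ, γ') (l', i', m')) := by
        simp only [margC, Matrix.of_apply, ind, Finset.mul_sum]
        simp only [← Fintype.sum_prod_type']
        refine Finset.sum_nbij' (fun z => (z.2.2.2.2.1, z.2.2.2.2.2, z.2.2.1, z.2.2.2.1, z.1, z.2.1))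
          (fun z => (z.2.2.2.2.1, z.2.2.2.2.2, z.2.2.1, z.2.2.2.1, z.1, z.2.1))
          ?_ ?_ ?_ ?_ ?_ <;> simp
        intros
        ring
      _ = _ := by simp only [hσ, sum_mul_ite_eq_of_trace_eq_one ρB hB]
  ext ⟨⟨β, γ⟩, i⟩ ⟨⟨β', γ'⟩, i'⟩
  calc
    _ = ∑ l, ∑ l', ∑ m, ∑ m', ρB l l' * ρC m m' *
        ∑ δ, U (β, δ, γ) (l, i, m) * star (U (β', δ, γ') (l', i', m')) := by
      simp only [ind, Finset.mul_sum]
      simp only [← Fintype.sum_prod_type']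
      refine Finset.sum_nbij' (fun z => (z.2.1, z.2.2.1, z.2.2.2.1, z.2.2.2.2, z.1))
        (fun z => (z.2.2.2.2, z.1, z.2.1, z.2.2.1, z.2.2.2.1)) ?_ ?_ ?_ ?_ ?_ <;> simp
      intros
      ring
    _ = ∑ k, margB ρ (β, i) (β', k) * margC ρ (γ, k) (γ', i') := by
      simp only [sum_mul_star_eq_sum_of_no_influence U hU σ τ hσ hτ, hmB, hmC,
        Finset.mul_sum, Finset.sum_mul]
      simp only [← Fintype.sum_prod_type']
      refine Finset.sum_nbij'
        (fun z => (z.2.2.2.2, z.2.2.1, z.2.2.2.1, z.1, z.2.1))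
        (fun z => (z.2.2.2.1, z.2.2.2.2, z.2.1, z.2.2.1, z.1)) ?_ ?_ ?_ ?_ ?_ <;> simp
      intros
      ring
    _ = _ := by
      simp [Matrix.mul_apply, extB, extC, Fintype.sum_prod_type]

end
end
end

section
/- Let ρ_{BC|A} be a CJ channel operator indexed by (b × c) × a satisfying ρ_{BC|A} = ↑ρ_{B|A} · ↑ρ_{C|A} (product of its extended marginals). Then ρ_{BC|A} admits a common-cause dilation: there exist finite types λB, λC, d, density matrices ρ_{λB}, ρ_{λC}, and a unitary U from inputs λB × a × λC to outputs b × d × c such that λB has no causal influence on C, λC has no causal influence on B, and the induced CJ channel operator equals ρ_{BC|A}. (Theorem 2, direction 2 ⇒ 1.) -/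
open Matrix BigOperators
open scoped ComplexOrder

noncomputable section

section
variable {b c a : Type*} [Fintype b] [Fintype c] [Fintype a]
  [DecidableEq a] [DecidableEq b] [DecidableEq c]
  [Nonempty a] [Nonempty b] [Nonempty c]

section Dilation
variable {o n κ : Type*} [Fintype o] [Fintype n] [Fintype κ]
  [DecidableEq o] [DecidableEq n] [DecidableEq κ]

/-- The block of `M` between the basis vectors `β` and `β'` of the first tensor factor. -/
def block (M : Matrix (o × n) (o × n) ℂ) (β β' : o) : Matrix n n ℂ :=
  Matrix.of fun i i' => M (β, i) (β', i')

theorem conjTranspose_block {o n : Type*} (M : Matrix (o × n) (o × n) ℂ) (β β' : o) :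
    (block M β β')ᴴ = block Mᴴ β' β :=
  rfl

theorem block_mul {o n : Type*} [Fintype o] [Fintype n] (M N : Matrix (o × n) (o × n) ℂ)
    (β β' : o) :
    block (M * N) β β' = ∑ γ, block M β γ * block N γ β' := by
  ext i i'
  simp [block, Matrix.mul_apply, Matrix.sum_apply, Fintype.sum_prod_type]

theorem commute_one_kronecker_iff (M : Matrix (o × n) (o × n) ℂ) (N : Matrix n n ℂ) :
    Commute M (kroneckerMap (· * ·) (1 : Matrix o o ℂ) N) ↔
      ∀ β β', Commute (block M β β') N := by
  have hN (β β' : o) : block (kroneckerMap (· * ·) (1 : Matrix o o ℂ) N) β β' =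
      if β = β' then N else 0 := by
    ext i i'
    by_cases h : β = β' <;> simp [block, h]
  have hl (β β' : o) : block (M * kroneckerMap (· * ·) (1 : Matrix o o ℂ) N) β β' =
      block M β β' * N := by simp [block_mul, hN]
  have hr (β β' : o) : block (kroneckerMap (· * ·) (1 : Matrix o o ℂ) N * M) β β' =
      N * block M β β' := by simp [block_mul, hN]
  constructor
  · intro h β β'
    rw [Commute, SemiconjBy, ← hl, ← hr, h.eq]
  · intro h
    ext ⟨β, i⟩ ⟨β', i'⟩
    have := congrFun (congrFun (h β β').eq i) i'
    rwa [← hl, ← hr] at this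

/-- A positive semidefinite matrix has a Hermitian square root, and every matrix commuting
with it commutes with the root. -/
theorem exists_hermitian_sqrt {M : Matrix κ κ ℂ} (hM : M.PosSemidef) :
    ∃ S : Matrix κ κ ℂ, Sᴴ = S ∧ S * S = M ∧ ∀ X, Commute M X → Commute S X := by
  have hsa : IsSelfAdjoint M := hM.1
  refine ⟨cfc Real.sqrt M, cfc_predicate Real.sqrt M, ?_, fun X hX => hX.cfc_real _⟩
  rw [← cfc_mul Real.sqrt Real.sqrt M]
  conv_rhs => rw [← cfc_id' ℝ M]
  refine cfc_congr fun x hx => Real.mul_self_sqrt ?_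
  simpa using (posSemidef_iff_isHermitian_and_spectrum_nonneg.1 hM).2 hx

/-- The Householder reflection along a vector `T` of squared norm `2` over a star ring
is an isometry. -/
theorem householder_isometry {R : Type*} [Ring R] [StarRing R] (T : κ → R)
    (hT : ∑ x, star (T x) * T x = 2) (l l' : κ) :
    ∑ x, star ((if x = l then 1 else 0) - T x * star (T l)) *
      ((if x = l' then 1 else 0) - T x * star (T l')) = if l = l' then 1 else 0 := by
  have h : ∑ x, T l * star (T x) * (T x * star (T l')) = T l * 2 * star (T l') := by
    rw [← hT, Finset.mul_sum, Finset.sum_mul]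
    simp only [mul_assoc]
  simp only [star_sub, star_mul, star_star, sub_mul, mul_sub, Finset.sum_sub_distrib, h,
    apply_ite star, star_one, star_zero, ite_mul, mul_ite, one_mul, zero_mul, mul_one, mul_zero,
    Finset.sum_ite_eq', Finset.mem_univ, if_true]
  rw [mul_two, add_mul]
  by_cases hl : l = l'
  · simp [hl]
  · simp [hl, Ne.symm hl]

/-- A channel operator is implemented by an isometry on its output, an ancilla and its input,
started from a fixed ancilla state `x₀`, whose blocks commute with every matrix commuting
with the blocks of the channel (up to the transposition of the Choi–Jamiołkowski convention). -/
theorem exists_isometry_of_isCJChannel [Nonempty o] {M : Matrix (o × n) (o × n) ℂ}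
    (hM : IsCJChannel M) :
    ∃ (P : o × Option o → Fin (Fintype.card (o × Option o)) → Matrix n n ℂ)
      (x₀ : Fin (Fintype.card (o × Option o))),
      (∀ l l', ∑ x, (P x l)ᴴ * P x l' = if l = l' then 1 else 0) ∧
      (∀ β β', ∑ e, (P (β', e) x₀)ᴴ * P (β, e) x₀ = (block M β β')ᵀ) ∧
      ∀ N : Matrix n n ℂ, (∀ β β', Commute (block M β β') N) → ∀ x l, Commute (P x l) Nᵀ := by
  obtain ⟨S, hSh, hSS, hSc⟩ := exists_hermitian_sqrt hM.1
  have hblock (β β' : o) : (block S β β')ᴴ = block S β' β := by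
    rw [conjTranspose_block, hSh]
  have hblockT (β β' : o) : (block S β β')ᵀᴴ = (block S β' β)ᵀ := by
    rw [← hblock β β']
    rfl
  have hMS (β β' : o) : ∑ e, (block S e β')ᵀ * (block S β e)ᵀ = (block M β β')ᵀ := by
    rw [← hSS, block_mul, Matrix.transpose_sum]
    simp only [Matrix.transpose_mul]
  have htr : ∑ β, (block M β β)ᵀ = 1 := by
    rw [← Matrix.transpose_sum, ← Matrix.transpose_one, ← hM.2]
    congr 1
    ext i i'
    simp [block, ptrace₁, Matrix.sum_apply]
  obtain ⟨β₀⟩ := ‹Nonempty o›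
  let V : o × Option o → Matrix n n ℂ := fun x => x.2.elim 0 fun e => (block S x.1 e)ᵀ
  let T : o × Option o → Matrix n n ℂ := fun x => (if x = (β₀, none) then 1 else 0) - V x
  have hV₀ : V (β₀, none) = 0 := rfl
  have hT₀ : T (β₀, none) = 1 := by simp [T, hV₀]
  have hVV : ∑ x, star (V x) * V x = 1 := by
    rw [Fintype.sum_prod_type, ← htr]
    refine Finset.sum_congr rfl fun β _ => ?_
    rw [← hMS, Fintype.sum_option]
    simp [V, star_eq_conjTranspose, hblockT]
  have hTT : ∑ x, star (T x) * T x = 2 := by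
    simp only [T, star_sub, sub_mul, mul_sub, Finset.sum_sub_distrib, hVV, apply_ite star,
      star_one, star_zero, ite_mul, mul_ite, one_mul, zero_mul, mul_one, mul_zero,
      Finset.sum_ite_eq', Finset.mem_univ, if_true, hV₀]
    norm_num
  let f := Fintype.equivFin (o × Option o)
  refine ⟨fun x l => (if x = f.symm l then 1 else 0) - T x * star (T (f.symm l)),
    f (β₀, none), fun l l' => ?_, fun β β' => ?_, fun N hN => ?_⟩
  · simpa [star_eq_conjTranspose] using householder_isometry T hTT (f.symm l) (f.symm l')
  · have hP (x : o × Option o) : (if x = (β₀, none) then 1 else 0) - T x = V x := by simp [T]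
    simp only [Equiv.symm_apply_apply, hT₀, star_one, mul_one, hP]
    rw [← hMS, Fintype.sum_option]
    simp [V, hblockT]
  · have hS (β β' : o) : Commute (block S β β')ᵀ Nᵀ := by
      have := (commute_one_kronecker_iff S N).1
        (hSc _ ((commute_one_kronecker_iff M N).2 hN)) β β'
      rw [Commute, SemiconjBy, ← Matrix.transpose_mul, ← Matrix.transpose_mul, this.eq]
    have hδ (p : Prop) [Decidable p] : Commute (if p then 1 else 0 : Matrix n n ℂ) Nᵀ := by
      split_ifs
      exacts [Commute.one_left _, Commute.zero_left _]
    have hV (x : o × Option o) : Commute (V x) Nᵀ ∧ Commute (star (V x)) Nᵀ := by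
      obtain ⟨β, _ | e⟩ := x
      · simp [V]
      · exact ⟨hS β e, by simpa [V, star_eq_conjTranspose, hblockT] using hS e β⟩
    have hT (x : o × Option o) : Commute (T x) Nᵀ ∧ Commute (star (T x)) Nᵀ := by
      refine ⟨(hδ _).sub_left (hV x).1, ?_⟩
      simp only [T, star_sub, apply_ite star, star_one, star_zero]
      exact (hδ _).sub_left (hV x).2
    exact fun x l => (hδ _).sub_left ((hT x).1.mul_left (hT _).2)

theorem sum_mul_star_eq {n : Type*} [Fintype n] (X Y : Matrix n n ℂ) (i i' : n) :
    ∑ j, X j i * star (Y j i') = (Yᴴ * X) i' i := by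
  simp [Matrix.mul_apply, mul_comm]

end Dilation

section Marginals
variable {o q n : Type*} [Fintype o] [Fintype q] [Fintype n]

theorem IsCJChannel.margB [DecidableEq n] {ρ : Matrix ((o × q) × n) ((o × q) × n) ℂ}
    (hρ : IsCJChannel ρ) : IsCJChannel (margB ρ) := by
  refine ⟨?_, ?_⟩
  · have h : _root_.margB ρ = ∑ γ, ρ.submatrix (fun p : o × n => ((p.1, γ), p.2))
        (fun p => ((p.1, γ), p.2)) := by
      ext p r
      simp [_root_.margB, Matrix.sum_apply]
    rw [h]
    exact posSemidef_sum _ fun γ _ => hρ.1.submatrix _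
  · rw [← hρ.2]
    ext i i'
    simp [_root_.margB, ptrace₁, Fintype.sum_prod_type]

theorem IsCJChannel.margC [DecidableEq n] {ρ : Matrix ((o × q) × n) ((o × q) × n) ℂ}
    (hρ : IsCJChannel ρ) : IsCJChannel (margC ρ) := by
  refine ⟨?_, ?_⟩
  · have h : _root_.margC ρ = ∑ β, ρ.submatrix (fun p : q × n => ((β, p.1), p.2))
        (fun p => ((β, p.1), p.2)) := by
      ext p r
      simp [_root_.margC, Matrix.sum_apply]
    rw [h]
    exact posSemidef_sum _ fun γ _ => hρ.1.submatrix _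
  · rw [← hρ.2]
    ext i i'
    simp only [_root_.margC, ptrace₁, Fintype.sum_prod_type, Matrix.of_apply]
    exact Finset.sum_comm

variable [DecidableEq o] [DecidableEq q]

theorem extB_mul_extC_apply (M : Matrix (o × n) (o × n) ℂ) (N : Matrix (q × n) (q × n) ℂ)
    (β β' : o) (γ γ' : q) (i i' : n) :
    (extB M * extC N : Matrix ((o × q) × n) ((o × q) × n) ℂ) ((β, γ), i) ((β', γ'), i') =
      (block M β β' * block N γ γ') i i' := by
  simp only [extB, extC, block, Matrix.mul_apply, Matrix.of_apply, Fintype.sum_prod_type]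
  rw [Finset.sum_eq_single β' (by intro x _ hx; simp [hx]) (by simp),
    Finset.sum_eq_single γ (by intro x _ hx; simp [hx.symm]) (by simp)]
  simp

/-- If the product of the extended operators is Hermitian, their blocks commute. -/
theorem commute_block_of_isHermitian {M : Matrix (o × n) (o × n) ℂ}
    {N : Matrix (q × n) (q × n) ℂ} (hM : M.IsHermitian) (hN : N.IsHermitian)
    (h : (extB M * extC N : Matrix ((o × q) × n) ((o × q) × n) ℂ).IsHermitian)
    (β β' : o) (γ γ' : q) :
    Commute (block M β β') (block N γ γ') := by
  have key : block M β β' * block N γ γ' = (block M β' β * block N γ' γ)ᴴ := by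
    ext i i'
    rw [Matrix.conjTranspose_apply, ← extB_mul_extC_apply, ← extB_mul_extC_apply]
    exact (h.apply _ _).symm
  rw [Commute, SemiconjBy, key, Matrix.conjTranspose_mul, conjTranspose_block, conjTranspose_block,
    hM.eq, hN.eq]

end Marginals

/-- Theorem 2, 2 ⇒ 1: a channel that factorizes as the product of its extended marginals
admits a common-cause dilation. -/
theorem factorization_implies_dilation (ρ : Matrix ((b × c) × a) ((b × c) × a) ℂ)
    (hρ : IsCJChannel ρ)
    (hfact : ρ = extB (margB ρ) * extC (margC ρ)) :
    Nonempty (CommonCauseDilation ρ) := by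
  have hB := hρ.margB
  have hC := hρ.margC
  have hcomm := commute_block_of_isHermitian hB.1.1 hC.1.1 (hfact ▸ hρ.1.1)
  obtain ⟨P, l₀, hP, hPM, hPc⟩ := exists_isometry_of_isCJChannel hB
  obtain ⟨Q, m₀, hQ, hQM, hQc⟩ := exists_isometry_of_isCJChannel hC
  have hPN (γ γ' x l) : Commute (P x l) (block (margC ρ) γ γ')ᵀ :=
    hPc _ (fun β β' => hcomm β β' γ γ') x l
  have hMQ (β β' y m) : Commute (block (margB ρ) β β')ᵀ (Q y m) :=
    (hQc _ (fun γ γ' => (hcomm β β' γ γ').symm) y m).symm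
  have hPQ (x l y m) : Commute (P x l) (Q y m) := by
    have h := hQc (P x l)ᵀ (fun γ γ' => by
      have := (hPN γ γ' x l).symm
      rw [Commute, SemiconjBy, ← Matrix.transpose_inj]
      simpa using this.symm.eq) y m
    simpa using h.symm
  let e := Fintype.equivFin (Option b × a × Option c)
  obtain ⟨U, hU⟩ : ∃ U : Matrix (b × Fin (Fintype.card (Option b × a × Option c)) × c)
      (Fin (Fintype.card (b × Option b)) × a × Fin (Fintype.card (c × Option c))) ℂ,
      ∀ β β' γ γ' l l' i i' m m',
        ∑ δ, U (β, δ, γ) (l, i, m) * star (U (β', δ, γ') (l', i', m')) =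
          ∑ g, ∑ f, ((P (β', g) l' * Q (γ', f) m')ᴴ * (P (β, g) l * Q (γ, f) m)) i' i := by
    refine ⟨Matrix.of fun r s => (P (r.1, (e.symm r.2.1).1) s.1 *
      Q (r.2.2, (e.symm r.2.1).2.2) s.2.2) (e.symm r.2.1).2.1 s.2.1,
      fun β β' γ γ' l l' i i' m m' => ?_⟩
    rw [← e.sum_comp]
    simp only [Matrix.of_apply, Equiv.symm_apply_apply, Fintype.sum_prod_type]
    refine Finset.sum_congr rfl fun g _ => ?_
    rw [Finset.sum_comm]
    exact Finset.sum_congr rfl fun f _ => sum_mul_star_eq _ _ _ _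
  have hUQ (β β' γ γ' l l' i i' m m') :
      ∑ δ, U (β, δ, γ) (l, i, m) * star (U (β', δ, γ') (l', i', m')) =
        (∑ f, (Q (γ', f) m')ᴴ * (∑ g, (P (β', g) l')ᴴ * P (β, g) l) * Q (γ, f) m) i' i := by
    rw [hU, Finset.sum_comm]
    simp only [Finset.mul_sum, Finset.sum_mul, Matrix.sum_apply, Matrix.conjTranspose_mul,
      Matrix.mul_assoc]
  have hUP (β β' γ γ' l l' i i' m m') :
      ∑ δ, U (β, δ, γ) (l, i, m) * star (U (β', δ, γ') (l', i', m')) =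
        (∑ g, (P (β', g) l')ᴴ * (∑ f, (Q (γ', f) m')ᴴ * Q (γ, f) m) * P (β, g) l) i' i := by
    rw [hU]
    simp only [Finset.mul_sum, Finset.sum_mul, Matrix.sum_apply, (hPQ _ _ _ _).eq,
      Matrix.conjTranspose_mul, Matrix.mul_assoc]
  have hUtraceB (l l' γ γ' i i' m m') :
      ∑ β, ∑ δ, U (β, δ, γ) (l, i, m) * star (U (β, δ, γ') (l', i', m')) =
        (if l = l' then 1 else 0) * (∑ f, (Q (γ', f) m')ᴴ * Q (γ, f) m) i' i := by
    simp only [hUQ]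
    rw [← Matrix.sum_apply, Finset.sum_comm]
    simp only [← Finset.sum_mul, ← Finset.mul_sum]
    rw [← Fintype.sum_prod_type', hP]
    by_cases h : l = l'
    · simp [h]
    · simp [h, Ne.symm h]
  have hUtraceC (m m' β β' l l' i i') :
      ∑ δ, ∑ γ, U (β, δ, γ) (l, i, m) * star (U (β', δ, γ) (l', i', m')) =
        (if m = m' then 1 else 0) * (∑ g, (P (β', g) l')ᴴ * P (β, g) l) i' i := by
    rw [Finset.sum_comm]
    simp only [hUP]
    rw [← Matrix.sum_apply, Finset.sum_comm]
    simp only [← Finset.sum_mul, ← Finset.mul_sum]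
    rw [← Fintype.sum_prod_type', hQ]
    by_cases h : m = m'
    · simp [h]
    · simp [h, Ne.symm h]
  have hcard : Fintype.card (Fin (Fintype.card (b × Option b))) * Fintype.card a *
      Fintype.card (Fin (Fintype.card (c × Option c))) =
      Fintype.card b * Fintype.card (Fin (Fintype.card (Option b × a × Option c))) *
        Fintype.card c := by
    simp only [Fintype.card_fin, Fintype.card_prod]
    ring
  have hUU : Uᴴ * U = 1 := by
    ext ⟨l, i, m⟩ ⟨l', i', m'⟩
    have h : (Uᴴ * U) (l, i, m) (l', i', m') =
        ∑ γ, ∑ β, ∑ δ, U (β, δ, γ) (l', i', m') * star (U (β, δ, γ) (l, i, m)) := by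
      simp only [Matrix.mul_apply, Matrix.conjTranspose_apply, Fintype.sum_prod_type]
      conv_rhs => rw [Finset.sum_comm]
      refine Finset.sum_congr rfl fun β _ => ?_
      rw [Finset.sum_comm]
      exact Finset.sum_congr rfl fun γ _ => Finset.sum_congr rfl fun δ _ => mul_comm _ _
    simp only [h, hUtraceB]
    rw [← Finset.mul_sum, ← Matrix.sum_apply, ← Fintype.sum_prod_type', hQ]
    simp only [Matrix.one_apply, Prod.mk.injEq]
    by_cases h₁ : l = l' <;> by_cases h₂ : m = m' <;> simp [h₁, h₂, Matrix.one_apply, eq_comm]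
  have hUU' : U * Uᴴ = 1 := by
    refine (mul_eq_one_comm_of_card_eq _ _ _ ?_).1 hUU
    simpa only [Fintype.card_prod, mul_assoc] using hcard
  have hstate {k : ℕ} (x : Fin k) :
      (Matrix.diagonal (Pi.single x 1 : Fin k → ℂ)).PosSemidef ∧
        (Matrix.diagonal (Pi.single x 1 : Fin k → ℂ)).trace = 1 := by
    refine ⟨Matrix.PosSemidef.diagonal ?_, by simp [Matrix.trace_diagonal]⟩
    exact Pi.single_nonneg.2 zero_le_one
  have : Nonempty (Fin (Fintype.card (b × Option b))) := ⟨l₀⟩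
  have : Nonempty (Fin (Fintype.card (c × Option c))) := ⟨m₀⟩
  have : Nonempty (Fin (Fintype.card (Option b × a × Option c))) :=
    ⟨e (none, Classical.arbitrary a, none)⟩
  exact ⟨{
    lamB := Fin (Fintype.card (b × Option b))
    lamC := Fin (Fintype.card (c × Option c))
    d := Fin (Fintype.card (Option b × a × Option c))
    card_eq := hcard
    U := U
    hU := ⟨hUU', hUU⟩
    ρlamB := Matrix.diagonal (Pi.single l₀ 1)
    ρlamC := Matrix.diagonal (Pi.single m₀ 1)
    hρlamB := hstate l₀
    hρlamC := hstate m₀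
    induced := fun β β' γ γ' i i' => by
      have h : ∀ δ, ∑ l, ∑ l', ∑ m, ∑ m', U (β, δ, γ) (l, i, m) *
          Matrix.diagonal (Pi.single l₀ 1) l l' * Matrix.diagonal (Pi.single m₀ 1) m m' *
          star (U (β', δ, γ') (l', i', m')) =
          U (β, δ, γ) (l₀, i, m₀) * star (U (β', δ, γ') (l₀, i', m₀)) := fun δ => by
        simp [Matrix.diagonal_apply, Pi.single_apply]
      simp only [h, hUQ, hPM]
      conv_lhs => rw [hfact]
      simp only [Matrix.mul_assoc, (hMQ _ _ _ _).eq]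
      simp only [← Matrix.mul_assoc]
      rw [extB_mul_extC_apply, ← Finset.sum_mul, hQM, ← Matrix.transpose_mul]
      rfl
    no_influence_lamB_on_C :=
      ⟨Matrix.of fun r s => (∑ f, (Q (s.1, f) s.2.2)ᴴ * Q (r.1, f) r.2.2) s.2.1 r.2.1,
        fun γ γ' l l' i i' m m' => hUtraceB l l' γ γ' i i' m m'⟩
    no_influence_lamC_on_B :=
      ⟨Matrix.of fun r s => (∑ g, (P (s.1, g) s.2.1)ᴴ * P (r.1, g) r.2.1) s.2.2 r.2.2,
        fun β β' l l' i i' m m' => hUtraceC m m' β β' l l' i i'⟩ }⟩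

end
end
end

section
/- Let ρ_{BC|A} be a CJ channel operator indexed by (b × c) × a satisfying ρ_{BC|A} = ↑ρ_{B|A} · ↑ρ_{C|A} (product of its extended marginals). Then the quantum conditional mutual information I(B:C|A) evaluated on the trace-one operator ρ̂ := (1 / card a) · ρ_{BC|A} (with systems grouped as B, C, A) equals 0. (Theorem 3, implication from condition 2 to condition 3.) -/
open Matrix BigOperators
open scoped ComplexOrder

noncomputable section

section MatrixFunctions

open Polynomial

variable {n : Type*} [Fintype n] [DecidableEq n]

theorem Matrix.aeval_mulVec_of_mulVec_eq_smul {M : Matrix n n ℂ} {v : n → ℂ} {r : ℝ}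
    (h : M *ᵥ v = r • v) (p : ℝ[X]) : aeval M p *ᵥ v = p.eval r • v := by
  induction p using Polynomial.induction_on' with
  | add p q hp hq => simp [add_mulVec, hp, hq, add_smul]
  | monomial k c =>
    have hk : M ^ k *ᵥ v = r ^ k • v := by
      induction k with
      | zero => simp
      | succ k ih => rw [pow_succ, ← mulVec_mulVec, h, mulVec_smul, ih, smul_smul, pow_succ']
    rw [aeval_monomial, eval_monomial, Algebra.algebraMap_eq_smul_one, smul_mul_assoc, one_mul,
      smul_mulVec, hk, smul_smul]

theorem Matrix.mem_spectrum_real_of_mulVec_eq_smul {M : Matrix n n ℂ} {v : n → ℂ} {r : ℝ}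
    (hv : v ≠ 0) (h : M *ᵥ v = r • v) : r ∈ spectrum ℝ M := by
  rw [spectrum.mem_iff, Matrix.isUnit_iff_isUnit_det, isUnit_iff_ne_zero, not_not,
    ← exists_mulVec_eq_zero_iff]
  exact ⟨v, hv, by
    rw [Algebra.algebraMap_eq_smul_one, sub_mulVec, h, smul_mulVec, one_mulVec, sub_self]⟩

/-- There is a real polynomial agreeing with the logarithm on a finite set. -/
theorem exists_polynomial_eval_eq_log {s : Set ℝ} (hs : s.Finite) :
    ∃ p : ℝ[X], ∀ x ∈ s, p.eval x = Real.log x :=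
  ⟨Lagrange.interpolate hs.toFinset id Real.log, fun _ hx ↦
    Lagrange.eval_interpolate_at_node (v := id) Real.log (Set.injOn_id _)
      (hs.mem_toFinset.2 hx)⟩

theorem vNEntropy_eq_neg_trace {M : Matrix n n ℂ} (hM : M.IsHermitian) {p : ℝ[X]}
    (hp : ∀ x ∈ spectrum ℝ M, p.eval x = Real.log x) :
    vNEntropy M = -(M * aeval M p).trace.re := by
  have htr : (M * aeval M p).trace =
      ∑ i, ((hM.eigenvalues i * p.eval (hM.eigenvalues i) : ℝ) : ℂ) := by
    have h : M * aeval M p = hM.cfc (X * p).eval := by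
      have hq : aeval M (X * p) = M * aeval M p := by rw [map_mul, aeval_X]
      rw [← hq, ← cfc_polynomial (X * p) M hM]
      exact hM.cfc_eq _
    rw [h, IsHermitian.cfc, Unitary.conjStarAlgAut_apply, trace_mul_comm, ← mul_assoc]
    simp [trace]
  rw [htr, ← Complex.ofReal_sum, Complex.ofReal_re, vNEntropy, dif_pos hM]
  congr 1
  refine Eq.trans ?_ (Finset.sum_congr rfl fun i _ ↦ congrArg (hM.eigenvalues i * ·)
    (hp _ (hM.eigenvalues_mem_spectrum_real i)).symm)
  congr!

/-- Matrices agreeing on the joint eigenvectors of a commuting Hermitian pair are equal. -/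
theorem Matrix.ext_of_commute_of_isHermitian {X Y S T : Matrix n n ℂ} (hX : X.IsHermitian)
    (hY : Y.IsHermitian) (hXY : Commute X Y)
    (h : ∀ (v : n → ℂ) (α β : ℝ), v ≠ 0 → X *ᵥ v = α • v → Y *ᵥ v = β • v → S *ᵥ v = T *ᵥ v) :
    S = T := by
  have hX' := isSymmetric_toEuclideanLin_iff.2 hX
  have hY' := isSymmetric_toEuclideanLin_iff.2 hY
  have hc : Commute X.toEuclideanLin Y.toEuclideanLin :=
    hXY.map (toLpLinAlgEquiv (R := ℂ) (n := n) 2)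
  apply toEuclideanLin.injective
  rw [← LinearMap.eqLocus_eq_top, eq_top_iff,
    ← LinearMap.IsSymmetric.iSup_iSup_eigenspace_inf_eigenspace_eq_top_of_commute hX' hY' hc]
  refine iSup_le fun α ↦ iSup_le fun β v hv ↦ ?_
  obtain ⟨hα, hβ⟩ := hv
  by_cases hv0 : v = 0
  · simp [hv0]
  have hαr : ((α.re : ℝ) : ℂ) = α := Complex.conj_eq_iff_re.1 <|
    hX'.conj_eigenvalue_eq_self (Module.End.hasEigenvalue_of_hasEigenvector ⟨hα, hv0⟩)
  have hβr : ((β.re : ℝ) : ℂ) = β := Complex.conj_eq_iff_re.1 <|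
    hY'.conj_eigenvalue_eq_self (Module.End.hasEigenvalue_of_hasEigenvector ⟨hβ, hv0⟩)
  have hα' : X *ᵥ v.ofLp = α • v.ofLp := congrArg WithLp.ofLp (Module.End.mem_eigenspace_iff.1 hα)
  have hβ' : Y *ᵥ v.ofLp = β • v.ofLp := congrArg WithLp.ofLp (Module.End.mem_eigenspace_iff.1 hβ)
  rw [← hαr, Complex.coe_smul] at hα'
  rw [← hβr, Complex.coe_smul] at hβ'
  exact congrArg (WithLp.toLp 2) (h v.ofLp _ _ (by simpa using hv0) hα' hβ')

/-- The identity `z log z = z (log x + log y + log k)` for `z = k x y`, lifted to commuting Hermitian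
matrices, with a polynomial standing in for the logarithm. -/
theorem Matrix.smul_mul_mul_aeval_of_eval_eq_log {X Y : Matrix n n ℂ} (hX : X.IsHermitian)
    (hY : Y.IsHermitian) (hXY : Commute X Y) {k : ℝ} (hk : k ≠ 0) {p : ℝ[X]}
    (hpX : ∀ x ∈ spectrum ℝ X, p.eval x = Real.log x)
    (hpY : ∀ x ∈ spectrum ℝ Y, p.eval x = Real.log x)
    (hpXY : ∀ x ∈ spectrum ℝ (k • (X * Y)), p.eval x = Real.log x) :
    k • (X * Y) * aeval (k • (X * Y)) p =
      k • (X * Y) * (aeval X p + aeval Y p + Real.log k • 1) := by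
  refine Matrix.ext_of_commute_of_isHermitian hX hY hXY fun v α β hv hα hβ ↦ ?_
  have hZ : (k • (X * Y)) *ᵥ v = (k * (α * β)) • v := by
    rw [smul_mulVec, ← mulVec_mulVec, hβ, mulVec_smul, hα, smul_smul, smul_smul, mul_right_comm,
      mul_assoc]
  rw [← mulVec_mulVec, ← mulVec_mulVec, add_mulVec, add_mulVec,
    aeval_mulVec_of_mulVec_eq_smul hZ, aeval_mulVec_of_mulVec_eq_smul hα,
    aeval_mulVec_of_mulVec_eq_smul hβ, smul_mulVec (Real.log k), one_mulVec, ← add_smul, ← add_smul,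
    mulVec_smul, mulVec_smul, hZ, smul_smul, smul_smul,
    hpX _ (mem_spectrum_real_of_mulVec_eq_smul hv hα),
    hpY _ (mem_spectrum_real_of_mulVec_eq_smul hv hβ),
    hpXY _ (mem_spectrum_real_of_mulVec_eq_smul hv hZ)]
  congr 1
  rcases eq_or_ne α 0 with rfl | hα0
  · simp
  rcases eq_or_ne β 0 with rfl | hβ0
  · simp
  rw [Real.log_mul hk (mul_ne_zero hα0 hβ0), Real.log_mul hα0 hβ0]
  ring

end MatrixFunctions

section Marginals

open Polynomial

variable {b c a : Type*}

theorem Matrix.IsHermitian.margB [Fintype c] {ρ : Matrix ((b × c) × a) ((b × c) × a) ℂ}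
    (h : ρ.IsHermitian) : (margB ρ).IsHermitian :=
  .ext fun p q ↦ by simp [_root_.margB, ← h.apply ((p.1, _), p.2)]

theorem Matrix.IsHermitian.margC [Fintype b] {ρ : Matrix ((b × c) × a) ((b × c) × a) ℂ}
    (h : ρ.IsHermitian) : (margC ρ).IsHermitian :=
  .ext fun p q ↦ by simp [_root_.margC, ← h.apply ((_, p.1), p.2)]

theorem Matrix.IsHermitian.extB [DecidableEq c] {M : Matrix (b × a) (b × a) ℂ}
    (h : M.IsHermitian) : (extB M : Matrix ((b × c) × a) _ ℂ).IsHermitian :=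
  .ext fun p q ↦ by
    simp only [_root_.extB, of_apply, ← h.apply (p.1.1, p.2), eq_comm (a := q.1.2)]
    split_ifs <;> simp

theorem Matrix.IsHermitian.extC [DecidableEq b] {M : Matrix (c × a) (c × a) ℂ}
    (h : M.IsHermitian) : (extC M : Matrix ((b × c) × a) _ ℂ).IsHermitian :=
  .ext fun p q ↦ by
    simp only [_root_.extC, of_apply, ← h.apply (p.1.2, p.2), eq_comm (a := q.1.1)]
    split_ifs <;> simp

theorem margB_smul [Fintype c] (k : ℝ) (ρ : Matrix ((b × c) × a) ((b × c) × a) ℂ) :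
    margB (k • ρ) = k • margB ρ := by
  ext; simp [margB, Finset.mul_sum]

theorem margC_smul [Fintype b] (k : ℝ) (ρ : Matrix ((b × c) × a) ((b × c) × a) ℂ) :
    margC (k • ρ) = k • margC ρ := by
  ext; simp [margC, Finset.mul_sum]

theorem ptrace₁_smul [Fintype b] (k : ℝ) (M : Matrix (b × a) (b × a) ℂ) :
    ptrace₁ (k • M) = k • ptrace₁ M := by
  ext; simp [ptrace₁, Finset.mul_sum]

theorem trace_ptrace₁ [Fintype b] [Fintype a] (M : Matrix (b × a) (b × a) ℂ) :
    (ptrace₁ M).trace = M.trace := by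
  simp [ptrace₁, trace, Fintype.sum_prod_type_right]

/-- `extB` as an algebra homomorphism. -/
def extBAlgHom (b c a : Type*) [Fintype b] [Fintype c] [Fintype a] [DecidableEq b]
    [DecidableEq c] [DecidableEq a] :
    Matrix (b × a) (b × a) ℂ →ₐ[ℝ] Matrix ((b × c) × a) ((b × c) × a) ℂ :=
  AlgHom.ofLinearMap
    { toFun := extB
      map_add' := fun M N ↦ by ext; simp only [extB, of_apply, Matrix.add_apply, add_mul]
      map_smul' := fun k M ↦ by ext; simp [extB] }
    (by
      ext ⟨⟨i, j⟩, k⟩ ⟨⟨i', j'⟩, k'⟩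
      simp only [LinearMap.coe_mk, AddHom.coe_mk, extB, of_apply, one_apply, Prod.mk.injEq]
      split_ifs <;> simp_all)
    (fun M N ↦ by
      ext
      simp [extB, mul_apply, Fintype.sum_prod_type])

/-- `extC` as an algebra homomorphism. -/
def extCAlgHom (b c a : Type*) [Fintype b] [Fintype c] [Fintype a] [DecidableEq b]
    [DecidableEq c] [DecidableEq a] :
    Matrix (c × a) (c × a) ℂ →ₐ[ℝ] Matrix ((b × c) × a) ((b × c) × a) ℂ :=
  AlgHom.ofLinearMap
    { toFun := extC
      map_add' := fun M N ↦ by ext; simp only [extC, of_apply, Matrix.add_apply, add_mul]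
      map_smul' := fun k M ↦ by ext; simp [extC] }
    (by
      ext ⟨⟨i, j⟩, k⟩ ⟨⟨i', j'⟩, k'⟩
      simp only [LinearMap.coe_mk, AddHom.coe_mk, extC, of_apply, one_apply, Prod.mk.injEq]
      split_ifs <;> simp_all)
    (fun M N ↦ by
      ext
      simp [extC, mul_apply, Fintype.sum_prod_type])

variable [Fintype b] [Fintype c] [Fintype a] [DecidableEq b] [DecidableEq c] [DecidableEq a]

theorem trace_mul_extB (ρ : Matrix ((b × c) × a) ((b × c) × a) ℂ) (N : Matrix (b × a) (b × a) ℂ) :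
    (ρ * extBAlgHom b c a N).trace = (margB ρ * N).trace := by
  simp only [extBAlgHom, extB, margB, trace, mul_apply, Fintype.sum_prod_type, Finset.sum_mul,
    AlgHom.ofLinearMap_apply, LinearMap.coe_mk, AddHom.coe_mk, of_apply, diag_apply, mul_ite,
    mul_one, mul_zero, Finset.sum_ite_irrel, Finset.sum_const_zero,
    Finset.sum_ite_eq', Finset.mem_univ, if_true]
  refine Finset.sum_congr rfl fun _ _ ↦ ?_
  exact Finset.sum_comm.trans (Finset.sum_congr rfl fun _ _ ↦ Finset.sum_comm.trans
    (Finset.sum_congr rfl fun _ _ ↦ Finset.sum_comm))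

theorem trace_mul_extC (ρ : Matrix ((b × c) × a) ((b × c) × a) ℂ) (N : Matrix (c × a) (c × a) ℂ) :
    (ρ * extCAlgHom b c a N).trace = (margC ρ * N).trace := by
  simp only [extCAlgHom, extC, margC, trace, mul_apply, Fintype.sum_prod_type, Finset.sum_mul,
    AlgHom.ofLinearMap_apply, LinearMap.coe_mk, AddHom.coe_mk, of_apply, diag_apply, mul_ite,
    mul_one, mul_zero, Finset.sum_ite_irrel, Finset.sum_const_zero,
    Finset.sum_ite_eq', Finset.mem_univ, if_true]
  exact Finset.sum_comm.trans (Finset.sum_congr rfl fun _ _ ↦ Finset.sum_comm.trans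
    (Finset.sum_congr rfl fun _ _ ↦ Finset.sum_comm.trans
      (Finset.sum_congr rfl fun _ _ ↦ Finset.sum_comm)))

/-- For a unit-trace Hermitian `σ` with maximally mixed `A` marginal that is proportional to the
product of its extended marginals, the conditional mutual information vanishes. -/
theorem qcmiBCA_eq_zero_of_factorization [Nonempty a]
    {σ : Matrix ((b × c) × a) ((b × c) × a) ℂ} (hσ : σ.IsHermitian)
    (hA : ptrace₁ σ = ((Fintype.card a : ℝ)⁻¹) • 1)
    (hfact : σ = (Fintype.card a : ℝ) • (extB (margB σ) * extC (margC σ))) :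
    qcmiBCA σ = 0 := by
  set d := (Fintype.card a : ℝ) with hd
  have hd0 : d ≠ 0 := by simp [hd]
  obtain ⟨p, hp⟩ := exists_polynomial_eval_eq_log
    (((((finite_real_spectrum (A := margB σ)).union (finite_real_spectrum (A := margC σ))).union
      (finite_real_spectrum (A := σ))).union (finite_real_spectrum (A := ptrace₁ σ))).union
      (Set.finite_singleton d⁻¹))
  have hpB : ∀ x ∈ spectrum ℝ (margB σ), p.eval x = Real.log x := fun x hx ↦ hp x (by simp [hx])
  have hpC : ∀ x ∈ spectrum ℝ (margC σ), p.eval x = Real.log x := fun x hx ↦ hp x (by simp [hx])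
  have hpσ : ∀ x ∈ spectrum ℝ σ, p.eval x = Real.log x := fun x hx ↦ hp x (by simp [hx])
  have hpA : ∀ x ∈ spectrum ℝ (ptrace₁ σ), p.eval x = Real.log x := fun x hx ↦ hp x (by simp [hx])
  have hpd : p.eval d⁻¹ = Real.log d⁻¹ := hp _ (by simp)
  have htr : σ.trace = 1 := by
    rw [← trace_ptrace₁, hA, trace_smul, trace_one, hd, ← Complex.coe_smul]
    simp
  have hAH : (ptrace₁ σ).IsHermitian := by
    rw [hA]
    exact isHermitian_one.smul (star_trivial _)
  have hXH : (extBAlgHom b c a (margB σ)).IsHermitian := hσ.margB.extB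
  have hYH : (extCAlgHom b c a (margC σ)).IsHermitian := hσ.margC.extC
  have hσXY : σ = d • (extBAlgHom b c a (margB σ) * extCAlgHom b c a (margC σ)) := hfact
  have hcomm : Commute (extBAlgHom b c a (margB σ)) (extCAlgHom b c a (margC σ)) := by
    have h : (d • (extBAlgHom b c a (margB σ) * extCAlgHom b c a (margC σ))).IsHermitian :=
      hσXY ▸ hσ
    have h' := h.smul (k := d⁻¹) (star_trivial _)
    rw [smul_smul, inv_mul_cancel₀ hd0, one_smul] at h'
    exact (IsSelfAdjoint.commute_iff hXH hYH).2 h'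
  have key := smul_mul_mul_aeval_of_eval_eq_log hXH hYH hcomm hd0 (p := p)
    (fun x hx ↦ hpB x (AlgHom.spectrum_apply_subset _ _ hx))
    (fun x hx ↦ hpC x (AlgHom.spectrum_apply_subset _ _ hx))
    (hσXY ▸ hpσ)
  rw [← hσXY, aeval_algHom_apply, aeval_algHom_apply, mul_add, mul_add] at key
  have hre := congrArg (fun M ↦ (trace M).re) key
  simp only [trace_add, trace_mul_extB, trace_mul_extC, Complex.add_re, mul_smul_comm, mul_one,
    trace_smul, htr, Complex.real_smul, Complex.ofReal_re] at hre
  have hSA : vNEntropy (ptrace₁ σ) = Real.log d := by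
    rw [vNEntropy_eq_neg_trace hAH hpA, hA, ← Algebra.algebraMap_eq_smul_one,
      aeval_algebraMap_apply, ← map_mul, Algebra.algebraMap_eq_smul_one, trace_smul, trace_one,
      coe_aeval_eq_eval, hpd, Real.log_inv]
    simp [← hd]
    field_simp
  rw [qcmiBCA, vNEntropy_eq_neg_trace hσ.margB hpB, vNEntropy_eq_neg_trace hσ.margC hpC,
    vNEntropy_eq_neg_trace hσ hpσ, hSA, hre]
  ring

end Marginals

section
variable {b c a : Type*} [Fintype b] [Fintype c] [Fintype a]
  [DecidableEq a] [DecidableEq b] [DecidableEq c]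
  [Nonempty a] [Nonempty b] [Nonempty c]

/-- Theorem 3, 2 ⇒ 3: if a channel operator factorizes as the product of its extended
marginals, then the quantum conditional mutual information `I(B:C|A)` of its normalized
version vanishes. -/
theorem factorization_implies_cmi_zero (ρ : Matrix ((b × c) × a) ((b × c) × a) ℂ)
    (hρ : IsCJChannel ρ)
    (hfact : ρ = extB (margB ρ) * extC (margC ρ)) :
    qcmiBCA ((1 / (Fintype.card a : ℂ)) • ρ) = 0 := by
  set d := (Fintype.card a : ℝ) with hd
  have hd0 : d ≠ 0 := by simp [hd]
  have hscale : (1 / (Fintype.card a : ℂ)) • ρ = d⁻¹ • ρ := by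
    rw [← Complex.coe_smul, hd]; simp
  rw [hscale]
  have hfact' : d⁻¹ • ρ = d • (extB (margB (d⁻¹ • ρ)) * extC (margC (d⁻¹ • ρ))) := by
    have hX : (extB (margB (d⁻¹ • ρ)) : Matrix ((b × c) × a) _ ℂ) = d⁻¹ • extB (margB ρ) := by
      rw [margB_smul]; exact map_smul (extBAlgHom b c a) d⁻¹ (margB ρ)
    have hY : (extC (margC (d⁻¹ • ρ)) : Matrix ((b × c) × a) _ ℂ) = d⁻¹ • extC (margC ρ) := by
      rw [margC_smul]; exact map_smul (extCAlgHom b c a) d⁻¹ (margC ρ)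
    rw [hX, hY, smul_mul_smul_comm, ← hfact, smul_smul, mul_inv_cancel_left₀ hd0]
  refine qcmiBCA_eq_zero_of_factorization ?_ ?_ hfact'
  · exact hρ.1.isHermitian.smul (star_trivial _)
  · rw [ptrace₁_smul, hρ.2]

end
end
end

section
/- Let ρ_{BC|A} be a CJ channel operator indexed by (b × c) × a that admits a common-cause block form. Then ρ_{BC|A} = ↑ρ_{B|A} · ↑ρ_{C|A}, the product of its extended marginals. (Theorem 3, implication from condition 4 to condition 2.) -/
open Matrix BigOperators
open scoped ComplexOrder

noncomputable section

section
variable {b c a : Type*} [Fintype b] [Fintype c] [Fintype a]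
  [DecidableEq a] [DecidableEq b] [DecidableEq c]
  [Nonempty a] [Nonempty b] [Nonempty c]

/-- A common-cause block form for a channel operator `ρ_{BC|A}`: a unitary decomposition
of the input space as a direct sum of tensor products, with the channel factorizing
blockwise into a `B`-channel and a `C`-channel. -/
structure CommonCauseBlockForm (ρ : Matrix ((b × c) × a) ((b × c) × a) ℂ) where
  ι : Type
  [fintι : Fintype ι]
  [deceqι : DecidableEq ι]
  m : ι → ℕ
  n : ι → ℕ
  card_eq : ∑ i : ι, m i * n i = Fintype.card a
  V : Matrix (Σ i : ι, Fin (m i) × Fin (n i)) a ℂ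
  hV : IsUnitaryMat V
  ρB : ∀ i : ι, Matrix (b × Fin (m i)) (b × Fin (m i)) ℂ
  ρC : ∀ i : ι, Matrix (c × Fin (n i)) (c × Fin (n i)) ℂ
  hρB : ∀ i, (ρB i).PosSemidef ∧ ptrace₁ (ρB i) = 1
  hρC : ∀ i, (ρC i).PosSemidef ∧ ptrace₁ (ρC i) = 1
  offdiag : ∀ (β β' : b) (γ γ' : c) (s t : Σ i : ι, Fin (m i) × Fin (n i)), s.1 ≠ t.1 →
    conjOnA ρ V ((β, γ), s) ((β', γ'), t) = 0
  diag : ∀ (i : ι) (μ μ' : Fin (m i)) (ν ν' : Fin (n i)) (β β' : b) (γ γ' : c),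
    conjOnA ρ V ((β, γ), ⟨i, (μ, ν)⟩) ((β', γ'), ⟨i, (μ', ν')⟩) =
      ρB i (β, μ) (β', μ') * ρC i (γ, ν) (γ', ν')

/-- The block of a matrix on `o × a` at the output indices `p`, `q`. -/
def outBlock {o a : Type*} (M : Matrix (o × a) (o × a) ℂ) (p q : o) : Matrix a a ℂ :=
  Matrix.of fun x y => M (p, x) (q, y)

theorem conjOnA_apply_eq_mul {o σa a : Type*} [Fintype a] (M : Matrix (o × a) (o × a) ℂ)
    (V : Matrix σa a ℂ) (p q : o) (s t : σa) :
    conjOnA M V (p, s) (q, t) = (V * outBlock M p q * Vᴴ) s t := by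
  simp only [conjOnA, outBlock, Matrix.of_apply, Matrix.mul_apply, Matrix.conjTranspose_apply,
    Finset.sum_mul]
  exact Finset.sum_comm

theorem sum_outBlock_self {o a : Type*} [Fintype o] (M : Matrix (o × a) (o × a) ℂ) :
    ∑ p, outBlock M p p = ptrace₁ M := by
  ext x y
  simp [outBlock, ptrace₁, Matrix.sum_apply]

theorem outBlock_margB {b c a : Type*} [Fintype c]
    (ρ : Matrix ((b × c) × a) ((b × c) × a) ℂ) (β β' : b) :
    outBlock (margB ρ) β β' = ∑ γ, outBlock ρ (β, γ) (β', γ) := by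
  ext x y
  simp [outBlock, margB, Matrix.sum_apply]

theorem outBlock_margC {b c a : Type*} [Fintype b]
    (ρ : Matrix ((b × c) × a) ((b × c) × a) ℂ) (γ γ' : c) :
    outBlock (margC ρ) γ γ' = ∑ β, outBlock ρ (β, γ) (β, γ') := by
  ext x y
  simp [outBlock, margC, Matrix.sum_apply]

theorem outBlock_extB_mul_extC {b c a : Type*} [Fintype b] [Fintype c] [Fintype a]
    [DecidableEq b] [DecidableEq c] (M : Matrix (b × a) (b × a) ℂ)
    (N : Matrix (c × a) (c × a) ℂ) (β β' : b) (γ γ' : c) :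
    outBlock (extB M * extC N) (β, γ) (β', γ') = outBlock M β β' * outBlock N γ γ' := by
  ext x y
  simp [outBlock, extB, extC, Matrix.mul_apply, Fintype.sum_prod_type, Finset.sum_ite_irrel]

theorem conj_mul_conj_of_isUnitaryMat {y x : Type*} [Fintype y] [Fintype x] [DecidableEq y]
    [DecidableEq x] {V : Matrix y x ℂ} (hV : IsUnitaryMat V) (M N : Matrix x x ℂ) :
    V * M * Vᴴ * (V * N * Vᴴ) = V * (M * N) * Vᴴ := by
  calc V * M * Vᴴ * (V * N * Vᴴ) = V * M * (Vᴴ * V) * N * Vᴴ := by simp only [Matrix.mul_assoc]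
    _ = V * (M * N) * Vᴴ := by rw [hV.2, Matrix.mul_one, Matrix.mul_assoc V]

theorem conj_injective_of_isUnitaryMat {y x : Type*} [Fintype y] [Fintype x] [DecidableEq y]
    [DecidableEq x] {V : Matrix y x ℂ} (hV : IsUnitaryMat V) :
    Function.Injective fun M : Matrix x x ℂ => V * M * Vᴴ := by
  have key (M : Matrix x x ℂ) : Vᴴ * (V * M * Vᴴ) * V = M := by
    calc Vᴴ * (V * M * Vᴴ) * V = (Vᴴ * V) * M * (Vᴴ * V) := by simp only [Matrix.mul_assoc]
      _ = M := by rw [hV.2, Matrix.one_mul, Matrix.mul_one]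
  exact Function.LeftInverse.injective (g := fun M => Vᴴ * M * V) key

attribute [instance] CommonCauseBlockForm.fintι CommonCauseBlockForm.deceqι

namespace CommonCauseBlockForm

open scoped Kronecker

variable {b c a : Type*} [Fintype b] [Fintype c] [Fintype a] [DecidableEq a]
  {ρ : Matrix ((b × c) × a) ((b × c) × a) ℂ}

theorem conj_outBlock (BF : CommonCauseBlockForm ρ) (β β' : b) (γ γ' : c) :
    BF.V * outBlock ρ (β, γ) (β', γ') * BF.Vᴴ =
      Matrix.blockDiagonal' fun i =>
        outBlock (BF.ρB i) β β' ⊗ₖ outBlock (BF.ρC i) γ γ' := by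
  ext ⟨i, μ, ν⟩ ⟨j, μ', ν'⟩
  rw [← conjOnA_apply_eq_mul]
  by_cases h : i = j
  · subst h
    rw [BF.diag, Matrix.blockDiagonal'_apply_eq]
    rfl
  · rw [BF.offdiag _ _ _ _ _ _ h, Matrix.blockDiagonal'_apply_ne _ _ _ h]

theorem conj_outBlock_margB (BF : CommonCauseBlockForm ρ) (β β' : b) :
    BF.V * outBlock (margB ρ) β β' * BF.Vᴴ =
      Matrix.blockDiagonal' fun i =>
        outBlock (BF.ρB i) β β' ⊗ₖ (1 : Matrix (Fin (BF.n i)) (Fin (BF.n i)) ℂ) := by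
  simp only [outBlock_margB, Matrix.mul_sum, Matrix.sum_mul, conj_outBlock]
  simp only [← (BF.hρC _).2, ← sum_outBlock_self]
  ext ⟨i, μ, ν⟩ ⟨j, μ', ν'⟩
  by_cases h : i = j
  · subst h
    simp [Matrix.sum_apply, Finset.mul_sum]
  · simp [Matrix.sum_apply, Matrix.blockDiagonal'_apply_ne _ _ _ h]

theorem conj_outBlock_margC (BF : CommonCauseBlockForm ρ) (γ γ' : c) :
    BF.V * outBlock (margC ρ) γ γ' * BF.Vᴴ =
      Matrix.blockDiagonal' fun i =>
        (1 : Matrix (Fin (BF.m i)) (Fin (BF.m i)) ℂ) ⊗ₖ outBlock (BF.ρC i) γ γ' := by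
  simp only [outBlock_margC, Matrix.mul_sum, Matrix.sum_mul, conj_outBlock]
  simp only [← (BF.hρB _).2, ← sum_outBlock_self]
  ext ⟨i, μ, ν⟩ ⟨j, μ', ν'⟩
  by_cases h : i = j
  · subst h
    simp [Matrix.sum_apply, Finset.sum_mul]
  · simp [Matrix.sum_apply, Matrix.blockDiagonal'_apply_ne _ _ _ h]

theorem outBlock_eq_mul (BF : CommonCauseBlockForm ρ) (β β' : b) (γ γ' : c) :
    outBlock ρ (β, γ) (β', γ') = outBlock (margB ρ) β β' * outBlock (margC ρ) γ γ' := by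
  apply conj_injective_of_isUnitaryMat BF.hV
  simp only [← conj_mul_conj_of_isUnitaryMat BF.hV, conj_outBlock, conj_outBlock_margB,
    conj_outBlock_margC, ← Matrix.blockDiagonal'_mul, ← Matrix.mul_kronecker_mul,
    Matrix.mul_one, Matrix.one_mul]

end CommonCauseBlockForm

/-- Theorem 3, 4 ⇒ 2: a channel operator admitting a common-cause block form factorizes
as the product of its extended marginals. -/
theorem blockform_implies_factorization (ρ : Matrix ((b × c) × a) ((b × c) × a) ℂ)
    (hρ : IsCJChannel ρ) (BF : CommonCauseBlockForm ρ) :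
    ρ = extB (margB ρ) * extC (margC ρ) := by
  ext ⟨⟨β, γ⟩, x⟩ ⟨⟨β', γ'⟩, y⟩
  exact congr_fun₂ ((BF.outBlock_eq_mul β β' γ γ').trans
    (outBlock_extB_mul_extC (margB ρ) (margC ρ) β β' γ γ').symm) x y

end
end
end

section
/- Let ρ_{BC|A} be a CJ channel operator indexed by (b × c) × a that admits a common-cause block form. Then ρ_{BC|A} admits a common-cause dilation: there exist finite types λB, λC, d, density matrices ρ_{λB}, ρ_{λC}, and a unitary U from inputs λB × a × λC to outputs b × d × c such that λB has no causal influence on C, λC has no causal influence on B, and the induced CJ channel operator equals ρ_{BC|A}. (Theorem 2/3, implication from condition 4 to condition 1, proved in the appendix.) -/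
open Matrix BigOperators
open scoped ComplexOrder

noncomputable section

section
variable {b c a : Type*} [Fintype b] [Fintype c] [Fintype a]
  [DecidableEq a] [DecidableEq b] [DecidableEq c]
  [Nonempty a] [Nonempty b] [Nonempty c]

open scoped MatrixOrder in
/-- Every Choi–Jamiołkowski channel operator has a unitary Stinespring dilation, the ancilla being
prepared in the basis state `l₀`. -/
theorem IsCJChannel.exists_unitary_dilation {b a e l : Type*} [Fintype b] [Fintype a] [Fintype e]
    [Fintype l] [DecidableEq a] [DecidableEq l]
    (φ : e ≃ b × a) (hcard : Fintype.card l * Fintype.card a = Fintype.card b * Fintype.card e)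
    (l₀ : l) {M : Matrix (b × a) (b × a) ℂ} (hM : IsCJChannel M) :
    ∃ P : Matrix (b × e) (l × a) ℂ, Pᴴ * P = 1 ∧ ∀ β β' μ μ',
      ∑ k, P (β, k) (l₀, μ) * star (P (β', k) (l₀, μ')) = M (β, μ) (β', μ') := by
  classical
  obtain ⟨B, hB⟩ := CStarAlgebra.nonneg_iff_eq_star_mul_self.1 hM.1.nonneg
  have hgram : ∀ β β' μ μ', ∑ k, star (B (φ k) (β, μ)) * B (φ k) (β', μ') =
      M (β, μ) (β', μ') := by
    intro β β' μ μ'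
    rw [hB, Matrix.star_eq_conjTranspose, Matrix.mul_apply, ← Equiv.sum_comp φ]
    rfl
  let v : l × a → EuclideanSpace ℂ (b × e) := fun q =>
    WithLp.toLp 2 fun p => star (B (φ p.2) (p.1, q.2))
  let s : Set (l × a) := {q | q.1 = l₀}
  have hv : Orthonormal ℂ (s.domRestrict v) := by
    rw [orthonormal_iff_ite]
    rintro ⟨⟨l₁, μ⟩, rfl : l₁ = l₀⟩ ⟨⟨l₂, μ'⟩, rfl : l₂ = l₁⟩
    have htr : ∑ β, M (β, μ') (β, μ) = (1 : Matrix a a ℂ) μ' μ := by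
      rw [← hM.2]; rfl
    simp only [← hgram] at htr
    simp [v, Set.domRestrict_apply, PiLp.inner_apply, Fintype.sum_prod_type,
      Matrix.one_apply, eq_comm] at htr ⊢
    simpa only [mul_comm] using htr
  obtain ⟨o, ho⟩ := hv.exists_orthonormalBasis_extension_of_card_eq
    (by simp [hcard])
  refine ⟨Matrix.of fun p q => o q p, ?_, ?_⟩
  · ext q q'
    have := orthonormal_iff_ite.1 o.orthonormal q q'
    rw [PiLp.inner_apply] at this
    simpa [Matrix.mul_apply, Matrix.one_apply, mul_comm] using this
  · intro β β' μ μ'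
    simp only [Matrix.of_apply, ho (l₀, _) rfl]
    simpa [v] using hgram β β' μ μ'

/-- A matrix between index types of equal cardinality with orthonormal columns is unitary. -/
theorem IsUnitaryMat.of_conjTranspose_mul_self {y x : Type*} [Fintype y] [Fintype x]
    [DecidableEq y] [DecidableEq x] {U : Matrix y x ℂ} (h : Uᴴ * U = 1)
    (hcard : Fintype.card x = Fintype.card y) : IsUnitaryMat U :=
  ⟨(Matrix.mul_eq_one_comm_of_card_eq _ _ _ hcard).1 h, h⟩

/-- Conjugation of the input system by a unitary is inverted by the conjugate transpose. -/
theorem IsUnitaryMat.eq_sum_conjOnA {o s a : Type*} [Fintype a] [Fintype s] [DecidableEq a]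
    [DecidableEq s] {V : Matrix s a ℂ} (hV : IsUnitaryMat V) (ρ : Matrix (o × a) (o × a) ℂ)
    (p p' : o) (x x' : a) :
    ρ (p, x) (p', x') =
      ∑ t, ∑ t', conjOnA ρ V (p, t) (p', t') * (star (V t x) * V t' x') := by
  let R : Matrix a a ℂ := Matrix.of fun x x' => ρ (p, x) (p', x')
  have hR : Vᴴ * (V * R * Vᴴ) * V = R := by
    rw [← Matrix.mul_assoc, ← Matrix.mul_assoc, hV.2, Matrix.one_mul, Matrix.mul_assoc, hV.2,
      Matrix.mul_one]
  have hconj : ∀ t t', conjOnA ρ V (p, t) (p', t') = (V * R * Vᴴ) t t' := by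
    intro t t'
    simp only [conjOnA, Matrix.of_apply, Matrix.mul_apply, Matrix.conjTranspose_apply,
      Finset.sum_mul, R]
    exact Finset.sum_comm
  have := congrFun (congrFun hR x) x'
  rw [Matrix.mul_apply] at this
  simp only [Matrix.mul_apply (M := Vᴴ), Finset.sum_mul] at this
  rw [Finset.sum_comm] at this
  simp only [hconj]
  refine this.symm.trans ?_
  refine Finset.sum_congr rfl fun t _ => Finset.sum_congr rfl fun t' _ => ?_
  rw [Matrix.conjTranspose_apply]
  ring

/-- Interchange of two pairs of summations. -/
theorem sum_comm_pairs {e f m n : Type*} [Fintype e] [Fintype f] [Fintype m] [Fintype n]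
    (g : e → f → m → n → ℂ) :
    ∑ x, ∑ y, ∑ p, ∑ q, g x y p q = ∑ p, ∑ q, ∑ x, ∑ y, g x y p q := by
  simp only [← Fintype.sum_prod_type']
  simpa [Fintype.sum_prod_type] using
    Finset.sum_comm (s := Finset.univ) (t := Finset.univ)
      (f := fun (z : e × f) (r : m × n) => g z.1 z.2 r.1 r.2)

/-- Tracing out both outputs of a pair of operators acting on a weighted product input. -/
theorem sum_sum_mul_star_prod {e f m n : Type*} [Fintype e] [Fintype f] [Fintype m] [Fintype n]
    (A A' : e → m → ℂ) (B B' : f → n → ℂ) (w w' : m × n → ℂ) :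
    ∑ x, ∑ y, (∑ p : m × n, A x p.1 * B y p.2 * w p) *
        star (∑ q : m × n, A' x q.1 * B' y q.2 * w' q) =
      ∑ p : m × n, ∑ q : m × n, (∑ x, A x p.1 * star (A' x q.1)) *
        (∑ y, B y p.2 * star (B' y q.2)) * (w p * star (w' q)) := by
  have hterm : ∀ x y p q, A x p.1 * B y p.2 * w p * star (A' x q.1 * B' y q.2 * w' q) =
      A x p.1 * star (A' x q.1) * (B y p.2 * star (B' y q.2)) * (w p * star (w' q)) := by
    intro x y p q
    simp only [star_mul']
    ring
  simp only [star_sum, Finset.sum_mul_sum, hterm]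
  simp only [Finset.sum_mul]
  exact sum_comm_pairs _

/-- The operator `⨁ᵢ Pᵢ ⊗ Qᵢ` on a direct sum of tensor products, precomposed with the adjoint of
the decomposition `V` of the input system. -/
def blockDilation {ι b c a lB lC : Type*} {m n eB eC : ι → Type*} [∀ i, Fintype (m i)]
    [∀ i, Fintype (n i)] (V : Matrix (Σ i, m i × n i) a ℂ)
    (P : ∀ i, Matrix (b × eB i) (lB × m i) ℂ) (Q : ∀ i, Matrix (c × eC i) (lC × n i) ℂ) :
    Matrix (b × (Σ i, eB i × eC i) × c) (lB × a × lC) ℂ :=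
  Matrix.of fun p q => ∑ r : m p.2.1.1 × n p.2.1.1,
    P p.2.1.1 (p.1, p.2.1.2.1) (q.1, r.1) * Q p.2.1.1 (p.2.2, p.2.1.2.2) (q.2.2, r.2) *
      star (V ⟨p.2.1.1, r⟩ q.2.1)

section blockDilation

variable {ι b c a lB lC : Type*} {m n eB eC : ι → Type*} [Fintype ι]
  [∀ i, Fintype (m i)] [∀ i, Fintype (n i)] [∀ i, Fintype (eB i)] [∀ i, Fintype (eC i)]
  (V : Matrix (Σ i, m i × n i) a ℂ)
  (P : ∀ i, Matrix (b × eB i) (lB × m i) ℂ) (Q : ∀ i, Matrix (c × eC i) (lC × n i) ℂ)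

/-- Tracing out the environment of `blockDilation V P Q` traces out both environments blockwise. -/
theorem sum_blockDilation_mul_star (β β' : b) (γ γ' : c) (l l' : lB) (x x' : a) (k k' : lC) :
    ∑ δ, blockDilation V P Q (β, δ, γ) (l, x, k) *
        star (blockDilation V P Q (β', δ, γ') (l', x', k')) =
      ∑ i, ∑ p : m i × n i, ∑ q : m i × n i,
        (∑ e, P i (β, e) (l, p.1) * star (P i (β', e) (l', q.1))) *
        (∑ f, Q i (γ, f) (k, p.2) * star (Q i (γ', f) (k', q.2))) *
        (star (V ⟨i, p⟩ x) * V ⟨i, q⟩ x') := by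
  rw [Fintype.sum_sigma]
  refine Finset.sum_congr rfl fun i _ => ?_
  rw [Fintype.sum_prod_type]
  refine (sum_sum_mul_star_prod (fun e r => P i (β, e) (l, r)) (fun e r => P i (β', e) (l', r))
    (fun f r => Q i (γ, f) (k, r)) (fun f r => Q i (γ', f) (k', r)) (fun r => star (V ⟨i, r⟩ x))
    (fun r => star (V ⟨i, r⟩ x'))).trans ?_
  simp only [star_star]

/-- Orthonormality of the columns, with the row index a product. -/
theorem sum_mul_star_of_conjTranspose_mul_self {o e x : Type*} [Fintype o] [Fintype e]
    [DecidableEq x] {P : Matrix (o × e) x ℂ} (hP : Pᴴ * P = 1) (q q' : x) :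
    ∑ y, ∑ z, P (y, z) q * star (P (y, z) q') = if q = q' then 1 else 0 := by
  have := congrFun (congrFun hP q') q
  rw [Matrix.mul_apply, Fintype.sum_prod_type, Matrix.one_apply] at this
  simpa [mul_comm, eq_comm] using this

/-- The marginal on `B` of the Choi–Jamiołkowski operator of `blockDilation V P Q`, for a fixed
basis state of `lC`. -/
def blockMargB [∀ i, DecidableEq (n i)] : Matrix (b × (lB × a)) (b × (lB × a)) ℂ :=
  Matrix.of fun s t => ∑ i, ∑ p : m i × n i, ∑ q : m i × n i, (if p.2 = q.2 then 1 else 0) *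
    (∑ e, P i (s.1, e) (s.2.1, p.1) * star (P i (t.1, e) (t.2.1, q.1))) *
    (star (V ⟨i, p⟩ s.2.2) * V ⟨i, q⟩ t.2.2)

/-- The marginal on `C` of the Choi–Jamiołkowski operator of `blockDilation V P Q`, for a fixed
basis state of `lB`. -/
def blockMargC [∀ i, DecidableEq (m i)] : Matrix (c × (a × lC)) (c × (a × lC)) ℂ :=
  Matrix.of fun s t => ∑ i, ∑ p : m i × n i, ∑ q : m i × n i, (if p.1 = q.1 then 1 else 0) *
    (∑ f, Q i (s.1, f) (s.2.2, p.2) * star (Q i (t.1, f) (t.2.2, q.2))) *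
    (star (V ⟨i, p⟩ s.2.1) * V ⟨i, q⟩ t.2.1)

variable {P Q}

/-- If the `P i` are isometries, `lB` has no causal influence on `c`. -/
theorem sum_sum_blockDilation_mul_star_left [Fintype b] [DecidableEq lB]
    [∀ i, DecidableEq (m i)] (hP : ∀ i, (P i)ᴴ * P i = 1)
    (γ γ' : c) (l l' : lB) (x x' : a) (k k' : lC) :
    ∑ β, ∑ δ, blockDilation V P Q (β, δ, γ) (l, x, k) *
        star (blockDilation V P Q (β, δ, γ') (l', x', k')) =
      (if l = l' then 1 else 0) * blockMargC V Q (γ, (x, k)) (γ', (x', k')) := by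
  simp only [sum_blockDilation_mul_star, blockMargC, Matrix.of_apply,
    Finset.mul_sum (s := (Finset.univ : Finset ι))]
  rw [Finset.sum_comm]
  refine Finset.sum_congr rfl fun i _ => ?_
  rw [Finset.sum_comm, Finset.mul_sum]
  refine Finset.sum_congr rfl fun p _ => ?_
  rw [Finset.sum_comm, Finset.mul_sum]
  refine Finset.sum_congr rfl fun q _ => ?_
  rw [← Finset.sum_mul, ← Finset.sum_mul, sum_mul_star_of_conjTranspose_mul_self (hP i)]
  by_cases hl : l = l' <;> simp [hl]

/-- If the `Q i` are isometries, `lC` has no causal influence on `b`. -/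
theorem sum_sum_blockDilation_mul_star_right [Fintype c] [DecidableEq lC]
    [∀ i, DecidableEq (n i)] (hQ : ∀ i, (Q i)ᴴ * Q i = 1)
    (β β' : b) (l l' : lB) (x x' : a) (k k' : lC) :
    ∑ δ, ∑ γ, blockDilation V P Q (β, δ, γ) (l, x, k) *
        star (blockDilation V P Q (β', δ, γ) (l', x', k')) =
      (if k = k' then 1 else 0) * blockMargB V P (β, (l, x)) (β', (l', x')) := by
  rw [Finset.sum_comm]
  simp only [sum_blockDilation_mul_star, blockMargB, Matrix.of_apply,
    Finset.mul_sum (s := (Finset.univ : Finset ι))]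
  rw [Finset.sum_comm]
  refine Finset.sum_congr rfl fun i _ => ?_
  rw [Finset.sum_comm, Finset.mul_sum]
  refine Finset.sum_congr rfl fun p _ => ?_
  rw [Finset.sum_comm, Finset.mul_sum]
  refine Finset.sum_congr rfl fun q _ => ?_
  rw [← Finset.sum_mul, ← Finset.mul_sum, sum_mul_star_of_conjTranspose_mul_self (hQ i)]
  by_cases hk : k = k' <;> simp [hk]

/-- `blockDilation V P Q` is an isometry if `V` and all the `P i`, `Q i` are. -/
theorem blockDilation_conjTranspose_mul_self [Fintype b] [Fintype c] [DecidableEq a]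
    [DecidableEq lB] [DecidableEq lC] [∀ i, DecidableEq (m i)] [∀ i, DecidableEq (n i)]
    {V : Matrix (Σ i, m i × n i) a ℂ} (hV : Vᴴ * V = 1)
    (hP : ∀ i, (P i)ᴴ * P i = 1) (hQ : ∀ i, (Q i)ᴴ * Q i = 1) :
    (blockDilation V P Q)ᴴ * blockDilation V P Q = 1 := by
  ext ⟨l', x', k'⟩ ⟨l, x, k⟩
  have hx := congrFun (congrFun hV x) x'
  rw [Matrix.mul_apply, Fintype.sum_sigma] at hx
  simp only [Matrix.conjTranspose_apply] at hx
  have hmul : ((blockDilation V P Q)ᴴ * blockDilation V P Q) (l', x', k') (l, x, k) =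
      ∑ γ, ∑ β, ∑ δ, blockDilation V P Q (β, δ, γ) (l, x, k) *
        star (blockDilation V P Q (β, δ, γ) (l', x', k')) := by
    rw [Matrix.mul_apply, Fintype.sum_prod_type, Finset.sum_comm (s := (Finset.univ : Finset c))]
    refine Finset.sum_congr rfl fun β _ => ?_
    rw [Fintype.sum_prod_type, Finset.sum_comm]
    simp only [Matrix.conjTranspose_apply, mul_comm]
  rw [hmul]
  simp only [sum_sum_blockDilation_mul_star_left V hP]
  simp only [← Finset.mul_sum, blockMargC, Matrix.of_apply]
  rw [Finset.sum_comm]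
  have hblock : ∀ i, (∑ γ, ∑ p : m i × n i, ∑ q : m i × n i,
        (if p.1 = q.1 then 1 else 0) *
        (∑ f, Q i (γ, f) (k, p.2) * star (Q i (γ, f) (k', q.2))) *
        (star (V ⟨i, p⟩ x) * V ⟨i, q⟩ x')) =
      (if k = k' then 1 else 0) * ∑ p : m i × n i, star (V ⟨i, p⟩ x) * V ⟨i, p⟩ x' := by
    intro i
    rw [Finset.sum_comm, Finset.mul_sum]
    refine Finset.sum_congr rfl fun p _ => ?_
    rw [Finset.sum_comm, Fintype.sum_eq_single p]
    · rw [← Finset.sum_mul, ← Finset.mul_sum, sum_mul_star_of_conjTranspose_mul_self (hQ i)]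
      simp
    · intro q hq
      rw [← Finset.sum_mul, ← Finset.mul_sum, sum_mul_star_of_conjTranspose_mul_self (hQ i)]
      have : p.1 = q.1 → p.2 ≠ q.2 := fun h₁ h₂ => hq (Prod.ext h₁ h₂).symm
      by_cases h₁ : p.1 = q.1 <;> simp [h₁, this]
  simp only [hblock, ← Finset.mul_sum, hx, Matrix.one_apply, Prod.mk.injEq]
  by_cases hl : l = l' <;> by_cases hk : k = k' <;> by_cases hxx : x = x' <;>
    simp [hl, hk, hxx, Ne.symm]

end blockDilation

/-- The pure state given by a basis vector is a density matrix. -/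
theorem posSemidef_single_and_trace {l : Type*} [Fintype l] [DecidableEq l] (l₀ : l) :
    (Matrix.single l₀ l₀ (1 : ℂ)).PosSemidef ∧ (Matrix.single l₀ l₀ (1 : ℂ)).trace = 1 := by
  refine ⟨?_, by simp⟩
  simpa [Matrix.diagonal_single] using
    Matrix.PosSemidef.diagonal (d := Pi.single l₀ (1 : ℂ)) (Pi.single_nonneg.2 zero_le_one)

/-- Sandwiching a pair of basis states evaluates the outer factors at the corresponding indices. -/
theorem sum_mul_single_mul_single_mul {l k : Type*} [Fintype l] [Fintype k] [DecidableEq l]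
    [DecidableEq k] (l₀ : l) (k₀ : k) (f g : l → k → ℂ) :
    ∑ x, ∑ x', ∑ y, ∑ y',
      f x y * Matrix.single l₀ l₀ 1 x x' * Matrix.single k₀ k₀ 1 y y' * g x' y' =
      f l₀ k₀ * g l₀ k₀ := by
  rw [Fintype.sum_eq_single l₀ fun x hx => by simp [Matrix.single_apply_of_row_ne hx.symm],
    Fintype.sum_eq_single l₀ fun x hx => by simp [Matrix.single_apply_of_col_ne _ _ hx.symm],
    Fintype.sum_eq_single k₀ fun y hy => by simp [Matrix.single_apply_of_row_ne hy.symm],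
    Fintype.sum_eq_single k₀ fun y hy => by simp [Matrix.single_apply_of_col_ne _ _ hy.symm]]
  simp

/-- Blockwise Stinespring unitaries assemble into a common-cause dilation. -/
def CommonCauseBlockForm.dilation {ρ : Matrix ((b × c) × a) ((b × c) × a) ℂ}
    (BF : CommonCauseBlockForm ρ) {lB lC : Type} {eB eC : BF.ι → Type}
    [Fintype lB] [Fintype lC] [DecidableEq lB] [DecidableEq lC]
    [∀ i, Fintype (eB i)] [∀ i, Fintype (eC i)]
    [∀ i, DecidableEq (eB i)] [∀ i, DecidableEq (eC i)] (lB₀ : lB) (lC₀ : lC)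
    (P : ∀ i, Matrix (b × eB i) (lB × Fin (BF.m i)) ℂ)
    (Q : ∀ i, Matrix (c × eC i) (lC × Fin (BF.n i)) ℂ)
    (hP : ∀ i, (P i)ᴴ * P i = 1) (hQ : ∀ i, (Q i)ᴴ * Q i = 1)
    (hPρ : ∀ i β β' μ μ', ∑ e, P i (β, e) (lB₀, μ) * star (P i (β', e) (lB₀, μ')) =
      BF.ρB i (β, μ) (β', μ'))
    (hQρ : ∀ i γ γ' ν ν', ∑ f, Q i (γ, f) (lC₀, ν) * star (Q i (γ', f) (lC₀, ν')) =
      BF.ρC i (γ, ν) (γ', ν'))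
    (hcard : letI := BF.fintι
      Fintype.card lB * Fintype.card a * Fintype.card lC =
        Fintype.card b * Fintype.card (Σ i, eB i × eC i) * Fintype.card c) :
    CommonCauseDilation ρ :=
  letI := BF.fintι
  letI := BF.deceqι
  { lamB := lB
    lamC := lC
    d := Σ i, eB i × eC i
    nonemptylamB := ⟨lB₀⟩
    nonemptylamC := ⟨lC₀⟩
    nonemptyd := by
      have : Nonempty lB := ⟨lB₀⟩
      have : Nonempty lC := ⟨lC₀⟩
      have hpos : 0 < Fintype.card lB * Fintype.card a * Fintype.card lC := by positivity
      rw [hcard] at hpos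
      exact Fintype.card_pos_iff.1
        (Nat.pos_of_mul_pos_left (Nat.pos_of_mul_pos_right hpos))
    card_eq := hcard
    U := blockDilation BF.V P Q
    hU := .of_conjTranspose_mul_self (blockDilation_conjTranspose_mul_self BF.hV.2 hP hQ) (by
      simpa only [Fintype.card_prod, mul_assoc] using hcard)
    ρlamB := Matrix.single lB₀ lB₀ 1
    ρlamC := Matrix.single lC₀ lC₀ 1
    hρlamB := posSemidef_single_and_trace lB₀
    hρlamC := posSemidef_single_and_trace lC₀
    induced := by
      intro β β' γ γ' x x'
      have hsum : ∀ δ : (Σ i, eB i × eC i), _ := fun δ =>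
        sum_mul_single_mul_single_mul lB₀ lC₀
          (fun l k => blockDilation BF.V P Q (β, δ, γ) (l, x, k))
          (fun l k => star (blockDilation BF.V P Q (β', δ, γ') (l, x', k)))
      simp only [hsum, sum_blockDilation_mul_star, hPρ, hQρ]
      rw [BF.hV.eq_sum_conjOnA ρ (β, γ) (β', γ') x x', Fintype.sum_sigma]
      refine Finset.sum_congr rfl fun i _ => Finset.sum_congr rfl fun p _ => ?_
      rw [Fintype.sum_sigma, Fintype.sum_eq_single i]
      · simp only [BF.diag]
      · intro j hj
        refine Finset.sum_eq_zero fun q _ => ?_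
        rw [BF.offdiag _ _ _ _ _ _ hj.symm, zero_mul]
    no_influence_lamB_on_C :=
      ⟨blockMargC BF.V Q, sum_sum_blockDilation_mul_star_left BF.V hP⟩
    no_influence_lamC_on_B :=
      ⟨blockMargB BF.V P, sum_sum_blockDilation_mul_star_right BF.V hQ⟩ }

/-- Theorem 2/3, 4 ⇒ 1: a channel operator admitting a common-cause block form admits a
common-cause dilation. -/
theorem blockform_implies_dilation (ρ : Matrix ((b × c) × a) ((b × c) × a) ℂ)
    (hρ : IsCJChannel ρ) (BF : CommonCauseBlockForm ρ) :
    Nonempty (CommonCauseDilation ρ) := by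
  choose P hP hPρ using fun i => IsCJChannel.exists_unitary_dilation
    (e := Fin (Fintype.card b) × Fin (BF.m i)) (l := Fin (Fintype.card b) × Fin (Fintype.card b))
    ((Fintype.equivFin b).symm.prodCongr (Equiv.refl _)) (by simp [mul_assoc])
    (⟨0, Fintype.card_pos⟩, ⟨0, Fintype.card_pos⟩) (BF.hρB i)
  choose Q hQ hQρ using fun i => IsCJChannel.exists_unitary_dilation
    (e := Fin (Fintype.card c) × Fin (BF.n i)) (l := Fin (Fintype.card c) × Fin (Fintype.card c))
    ((Fintype.equivFin c).symm.prodCongr (Equiv.refl _)) (by simp [mul_assoc])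
    (⟨0, Fintype.card_pos⟩, ⟨0, Fintype.card_pos⟩) (BF.hρC i)
  refine ⟨BF.dilation _ _ P Q hP hQ hPρ hQρ ?_⟩
  simp only [Fintype.card_sigma, Fintype.card_prod, Fintype.card_fin, ← BF.card_eq,
    Finset.mul_sum, Finset.sum_mul]
  exact Finset.sum_congr rfl fun i _ => by ring

end
end
end

section
/- Let x, y1, y2 be nonempty finite types with card x = card y1 · card y2 and let U be a unitary matrix with columns indexed by x and rows by y1 × y2. Then the quantum conditional mutual information I(Y1:Y2|X), evaluated on the trace-one operator ρ̂^U := (1 / card x) · ρ^U indexed by (y1 × y2) × x with systems grouped as (Y1, Y2, X), equals 0. (Appendix A, Eq. (A1): for the normalized CJ operator of a unitary, any two complementary output subsystems have vanishing conditional mutual information given the full input.) -/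
open Matrix BigOperators
open scoped ComplexOrder

noncomputable section

/-- A normalized multiple of `W * Wᴴ`, where the columns of `W` are orthogonal of equal norm, is
maximally mixed on its support: its entropy is the logarithm of the number of columns. -/
theorem vNEntropy_smul_mul_conjTranspose {n k : Type*} [Fintype n] [Fintype k] [Nonempty k]
    [DecidableEq k] (W : Matrix n k ℂ) (a t : ℝ) (hW : Wᴴ * W = (a : ℂ) • 1)
    (hat : t * a * Fintype.card k = 1) :
    vNEntropy ((t : ℂ) • (W * Wᴴ)) = Real.log (Fintype.card k) := by
  classical
  set M : Matrix n n ℂ := (t : ℂ) • (W * Wᴴ) with hM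
  have hk : (Fintype.card k : ℝ) ≠ 0 := by exact_mod_cast Fintype.card_ne_zero
  have hta : t * a = (Fintype.card k : ℝ)⁻¹ := eq_inv_of_mul_eq_one_left hat
  have hherm : M.IsHermitian := by
    simp [hM, Matrix.IsHermitian, conjTranspose_smul]
  have hsq : M * M = ((t * a : ℝ) : ℂ) • M := by
    have h : W * Wᴴ * (W * Wᴴ) = (a : ℂ) • (W * Wᴴ) := by
      rw [Matrix.mul_assoc, ← Matrix.mul_assoc Wᴴ, hW]
      simp
    rw [hM, Matrix.smul_mul, Matrix.mul_smul, h]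
    simp only [smul_smul]
    congr 1
    push_cast
    ring
  have htr : M.trace = 1 := by
    rw [hM, trace_smul, trace_mul_comm, hW, trace_smul, trace_one, smul_eq_mul, smul_eq_mul,
      ← mul_assoc]
    exact_mod_cast hat
  unfold vNEntropy
  rw [dif_pos hherm]
  have hsum : ∑ i, hherm.eigenvalues i = 1 := by
    have h := hherm.trace_eq_sum_eigenvalues
    rw [htr] at h
    apply Complex.ofReal_injective
    simpa using h.symm
  have hlog : ∀ i, hherm.eigenvalues i * Real.log (hherm.eigenvalues i) =
      hherm.eigenvalues i * -Real.log (Fintype.card k) := by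
    intro i
    set v : n → ℂ := ⇑(hherm.eigenvectorBasis i) with hv
    have hv0 : v ≠ 0 := fun h => hherm.eigenvectorBasis.toBasis.ne_zero i (by
      ext j; simpa using congrFun h j)
    have hev : M *ᵥ v = (hherm.eigenvalues i : ℂ) • v := by
      simpa using hherm.mulVec_eigenvectorBasis i
    have h2 : (((hherm.eigenvalues i) ^ 2 - (t * a) * hherm.eigenvalues i : ℝ) : ℂ) • v = 0 := by
      have h3 := congrArg (· *ᵥ v) hsq
      simp only [← Matrix.mulVec_mulVec, Matrix.smul_mulVec, hev, Matrix.mulVec_smul,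
        smul_smul] at h3
      push_cast
      rw [sub_smul, sub_eq_zero, pow_two, h3]
      push_cast
      rfl
    have h4 : hherm.eigenvalues i * (hherm.eigenvalues i - t * a) = 0 := by
      have := (smul_eq_zero.mp h2).resolve_right hv0
      have : (hherm.eigenvalues i) ^ 2 - (t * a) * hherm.eigenvalues i = 0 := by exact_mod_cast this
      linear_combination this
    rcases mul_eq_zero.mp h4 with h | h
    · simp [h]
    · rw [sub_eq_zero.mp h, hta, Real.log_inv]
  calc _ = -∑ i, hherm.eigenvalues i * -Real.log (Fintype.card k) := by
        congr 1
        convert Finset.sum_congr rfl fun i _ => hlog i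
    _ = _ := by rw [← Finset.sum_mul, hsum]; ring

/-- Appendix A, Eq. (A1): for the normalized CJ operator of a unitary, the two output
subsystems have vanishing conditional mutual information given the full input. -/
theorem cmi_outputs_given_input_of_unitary
    {y1 y2 x : Type*} [Fintype y1] [Fintype y2] [Fintype x]
    [Nonempty y1] [Nonempty y2] [Nonempty x]
    [DecidableEq y1] [DecidableEq y2] [DecidableEq x]
    (hcard : Fintype.card x = Fintype.card y1 * Fintype.card y2)
    (U : Matrix (y1 × y2) x ℂ) (hU : IsUnitaryMat U) :
    qcmiBCA ((1 / (Fintype.card x : ℂ)) • cjOf U) = 0 := by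
  have h1 : (Fintype.card y1 : ℝ) ≠ 0 := by exact_mod_cast Fintype.card_ne_zero
  have h2 : (Fintype.card y2 : ℝ) ≠ 0 := by exact_mod_cast Fintype.card_ne_zero
  have hc : (Fintype.card x : ℝ) = Fintype.card y1 * Fintype.card y2 := by exact_mod_cast hcard
  have hrow : ∀ p q, ∑ j, (starRingEnd ℂ) (U p j) * U q j = if p = q then 1 else 0 := fun p q => by
    simpa [Matrix.mul_apply, Matrix.one_apply, mul_comm, eq_comm] using
      congrFun (congrFun hU.1 q) p
  have hB := vNEntropy_smul_mul_conjTranspose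
    (Matrix.of fun (p : y1 × x) (γ : y2) => U (p.1, γ) p.2)
    (Fintype.card y1) (Fintype.card x : ℝ)⁻¹
    (by
      ext γ γ'
      simp [Matrix.mul_apply, Fintype.sum_prod_type, Matrix.one_apply, hrow])
    (by rw [hc]; field_simp)
  have hC := vNEntropy_smul_mul_conjTranspose
    (Matrix.of fun (p : y2 × x) (β : y1) => U (β, p.1) p.2)
    (Fintype.card y2) (Fintype.card x : ℝ)⁻¹
    (by
      ext β β'
      simp [Matrix.mul_apply, Fintype.sum_prod_type, Matrix.one_apply, hrow])
    (by rw [hc]; field_simp)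
  have hBC := vNEntropy_smul_mul_conjTranspose
    (Matrix.of fun (p : (y1 × y2) × x) (_ : Unit) => U p.1 p.2)
    (Fintype.card x) (Fintype.card x : ℝ)⁻¹
    (by
      ext
      simp [Matrix.mul_apply, Fintype.sum_prod_type, hrow, hcard])
    (by rw [hc]; simp; field_simp)
  have hA := vNEntropy_smul_mul_conjTranspose Uᵀ 1 (Fintype.card x : ℝ)⁻¹
    (by
      ext p q
      simp [Matrix.mul_apply, Matrix.one_apply, hrow])
    (by rw [Fintype.card_prod, Nat.cast_mul, hc]; field_simp)
  have key : qcmiBCA ((1 / (Fintype.card x : ℂ)) • cjOf U) =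
      Real.log (Fintype.card y2) + Real.log (Fintype.card y1) - Real.log (Fintype.card Unit)
        - Real.log (Fintype.card (y1 × y2)) := by
    rw [← hB, ← hC, ← hBC, ← hA, qcmiBCA]
    refine congrArg₂ _ (congrArg₂ _ (congrArg₂ _ ?_ ?_) ?_) ?_ <;> congr 1 <;> ext p q <;>
      simp [margB, margC, ptrace₁, cjOf, Matrix.mul_apply, Finset.mul_sum]
  rw [key, Fintype.card_prod, Nat.cast_mul, Real.log_mul h1 h2]
  simp
  ring

end
end

section
/- Let w, z, b, b̄ be nonempty finite types with card w · card z = card b · card b̄, and let U be a unitary matrix with columns indexed by w × z (inputs W, Z) and rows by b × b̄ (outputs B, B̄). Suppose the input subsystem Z has no causal influence on the output subsystem B: there exists a matrix σ indexed by b × w with (Tr_{B̄} ρ^U)((β,(j,i)),(β',(j',i'))) = [i = i']·σ((β,j),(β',j')) for all indices. Then the quantum conditional mutual information I(B:Z|W), evaluated on the trace-one operator (1/(card w · card z)) · Tr_{B̄} ρ^U indexed by b × (w × z) with systems grouped as (B, Z, W), equals 0. (Appendix A, Eq. (A3).) -/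
open Matrix BigOperators
open scoped ComplexOrder

noncomputable section

/-- Quantum conditional mutual information `I(B:Z|W)` of a matrix on `b × (w × z)`,
with systems grouped as `B`, `Z`, `W`. -/
def qcmiBZW {b w z : Type*} [Fintype b] [Fintype w] [Fintype z]
    (ρ : Matrix (b × (w × z)) (b × (w × z)) ℂ) : ℝ :=
  vNEntropy (Matrix.of fun (p q : b × w) => ∑ i : z, ρ (p.1, (p.2, i)) (q.1, (q.2, i)))
    + vNEntropy (ptrace₁ ρ)
    - vNEntropy ρ
    - vNEntropy (Matrix.of fun (j j' : w) => ∑ β : b, ∑ i : z, ρ (β, (j, i)) (β, (j', i)))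

theorem vNEntropy_eq_sum_negMulLog {n ι : Type*} [Fintype n] [DecidableEq n] [Fintype ι]
    {M : Matrix n n ℂ} (hM : M.IsHermitian) (d : ι → ℝ)
    (h : M.charpoly = ∏ i, (Polynomial.X - Polynomial.C (d i : ℂ))) :
    vNEntropy M = ∑ i, Real.negMulLog (d i) := by
  have hinst : Classical.decEq n = ‹DecidableEq n› := Subsingleton.elim _ _
  have hroots : Finset.univ.val.map hM.eigenvalues = Finset.univ.val.map d := by
    have h1 := hM.roots_charpoly_eq_eigenvalues
    rw [h, Polynomial.roots_prod _ _ (by simp [Finset.prod_ne_zero_iff, Polynomial.X_sub_C_ne_zero])]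
      at h1
    have h2 := congrArg (Multiset.map Complex.re) h1
    simpa [Function.comp_def] using h2.symm
  have hsum := congrArg (fun s => (s.map Real.negMulLog).sum) hroots
  simp only [Multiset.map_map, Function.comp_def] at hsum
  unfold vNEntropy
  rw [hinst]
  simp only [hM, dif_pos]
  rw [← Finset.sum_neg_distrib]
  simpa [Real.negMulLog_eq_neg] using hsum

theorem vNEntropy_eq_sum_eigenvalues {n : Type*} [Fintype n] [DecidableEq n]
    {M : Matrix n n ℂ} (hM : M.IsHermitian) :
    vNEntropy M = ∑ i, Real.negMulLog (hM.eigenvalues i) :=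
  vNEntropy_eq_sum_negMulLog hM _ hM.charpoly_eq

theorem Matrix.IsHermitian.charpoly_ofReal_smul {n : Type*} [Fintype n] [DecidableEq n]
    {M : Matrix n n ℂ} (hM : M.IsHermitian) (r : ℝ) :
    ((r : ℂ) • M).charpoly =
      ∏ i, (Polynomial.X - Polynomial.C ((r * hM.eigenvalues i : ℝ) : ℂ)) := by
  conv_lhs => rw [hM.spectral_theorem, Unitary.conjStarAlgAut_apply, ← Matrix.smul_mul,
    ← Matrix.mul_smul, Matrix.charpoly_mul_comm, ← mul_assoc]
  have h : (r : ℂ) • Matrix.diagonal (RCLike.ofReal ∘ hM.eigenvalues) =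
      Matrix.diagonal fun i => ((r * hM.eigenvalues i : ℝ) : ℂ) := by
    ext i j
    by_cases hij : i = j <;> simp [hij]
  rw [Unitary.coe_star_mul_self, one_mul, h, Matrix.charpoly_diagonal]

theorem Matrix.IsHermitian.ofReal_smul {n : Type*} {M : Matrix n n ℂ} (hM : M.IsHermitian)
    (r : ℝ) : ((r : ℂ) • M).IsHermitian := by
  rw [Matrix.IsHermitian, Matrix.conjTranspose_smul, hM.eq]
  simp

theorem vNEntropy_ofReal_smul {n : Type*} [Fintype n] {M : Matrix n n ℂ} (hM : M.IsHermitian)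
    (r : ℝ) :
    vNEntropy ((r : ℂ) • M) = r * vNEntropy M + Real.negMulLog r * M.trace.re := by
  classical
  rw [vNEntropy_eq_sum_negMulLog (hM.ofReal_smul r) _ (hM.charpoly_ofReal_smul r),
    vNEntropy_eq_sum_eigenvalues hM, hM.trace_eq_sum_eigenvalues]
  simp [Real.negMulLog_mul, Finset.sum_add_distrib, Finset.mul_sum, add_comm, mul_comm]

theorem vNEntropy_ofReal_smul_one {n : Type*} [Fintype n] [DecidableEq n] (r : ℝ) :
    vNEntropy ((r : ℂ) • (1 : Matrix n n ℂ)) = Fintype.card n * Real.negMulLog r := by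
  rw [vNEntropy_eq_sum_negMulLog (Matrix.isHermitian_one.ofReal_smul r) (fun _ : n => r)]
  · simp
  · rw [Matrix.smul_one_eq_diagonal, Matrix.charpoly_diagonal]

/-- The characteristic polynomial of a tensor product `A ⊗ 1`, up to reindexing. -/
theorem Matrix.charpoly_blockDiagonal_const {n z : Type*} [Fintype n] [DecidableEq n]
    [Fintype z] [DecidableEq z] (A : Matrix n n ℂ) :
    (Matrix.blockDiagonal fun _ : z => A).charpoly = A.charpoly ^ Fintype.card z := by
  have h : Matrix.charmatrix (Matrix.blockDiagonal fun _ : z => A) =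
      Matrix.blockDiagonal fun _ : z => Matrix.charmatrix A := by
    ext ⟨i, k⟩ ⟨j, l⟩
    by_cases hkl : k = l <;> by_cases hij : i = j <;>
      simp [Matrix.blockDiagonal_apply, hkl, hij]
  simp [Matrix.charpoly, h, Matrix.det_blockDiagonal]

theorem vNEntropy_blockDiagonal_const {n m z : Type*} [Fintype n] [Fintype m]
    [Fintype z] [DecidableEq z] {A : Matrix n n ℂ} (hA : A.IsHermitian) (e : n × z ≃ m) :
    vNEntropy (Matrix.reindex e e (Matrix.blockDiagonal fun _ : z => A)) =
      Fintype.card z * vNEntropy A := by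
  classical
  have hB : (Matrix.reindex e e (Matrix.blockDiagonal fun _ : z => A)).IsHermitian := by
    have h : (Matrix.blockDiagonal fun _ : z => A).IsHermitian := by
      rw [Matrix.IsHermitian, Matrix.blockDiagonal_conjTranspose, hA.eq]
    exact h.submatrix _
  rw [vNEntropy_eq_sum_eigenvalues hA,
    vNEntropy_eq_sum_negMulLog hB (fun p : z × n => hA.eigenvalues p.2)]
  · simp [Fintype.sum_prod_type]
  · rw [Matrix.charpoly_reindex, Matrix.charpoly_blockDiagonal_const, hA.charpoly_eq]
    simp [Fintype.prod_prod_type]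

/-- Appendix A, Eq. (A3): if the input subsystem `Z` of a unitary has no causal influence
on the output subsystem `B`, then `I(B:Z|W) = 0` on the normalized reduced CJ operator. -/
theorem cmi_zero_of_no_influence
    {w z b bbar : Type*} [Fintype w] [Fintype z] [Fintype b] [Fintype bbar]
    [Nonempty w] [Nonempty z] [Nonempty b] [Nonempty bbar]
    [DecidableEq w] [DecidableEq z] [DecidableEq b] [DecidableEq bbar]
    (hcard : Fintype.card w * Fintype.card z = Fintype.card b * Fintype.card bbar)
    (U : Matrix (b × bbar) (w × z) ℂ) (hU : IsUnitaryMat U)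
    (hni : ∃ σ : Matrix (b × w) (b × w) ℂ,
      ∀ (β β' : b) (j j' : w) (i i' : z),
        (∑ δ : bbar, cjOf U ((β, δ), (j, i)) ((β', δ), (j', i'))) =
          (if i = i' then 1 else 0) * σ (β, j) (β', j')) :
    qcmiBZW ((1 / ((Fintype.card w : ℂ) * (Fintype.card z : ℂ))) •
      Matrix.of fun (p q : b × (w × z)) =>
        ∑ δ : bbar, cjOf U ((p.1, δ), p.2) ((q.1, δ), q.2)) = 0 := by
  obtain ⟨σ, hσ⟩ := hni
  have hherm : σ.IsHermitian := by
    ext ⟨β, j⟩ ⟨β', j'⟩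
    have i : z := Classical.arbitrary z
    have h₁ := hσ β β' j j' i i
    have h₂ := hσ β' β j' j i i
    simp only [if_true, one_mul] at h₁ h₂
    rw [Matrix.conjTranspose_apply, ← h₁, ← h₂]
    simp [cjOf, mul_comm]
  have hUU (x y : w × z) :
      ∑ β : b, ∑ δ : bbar, U (β, δ) x * star (U (β, δ) y) = if x = y then 1 else 0 := by
    have h := congrFun (congrFun hU.2 y) x
    rw [Matrix.mul_apply, Fintype.sum_prod_type, Matrix.one_apply] at h
    simpa [mul_comm, eq_comm] using h
  have hσW (j j' : w) : ∑ β, σ (β, j) (β, j') = if j = j' then 1 else 0 := by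
    have i : z := Classical.arbitrary z
    have h := hUU (j, i) (j', i)
    simp only [Prod.mk.injEq, and_true] at h
    rw [← h]
    refine Finset.sum_congr rfl fun β _ => ?_
    simpa [cjOf] using (hσ β β j j' i i).symm
  have htrace : σ.trace = Fintype.card w := by
    rw [Matrix.trace, Fintype.sum_prod_type_right]
    simp [hσW]
  set c : ℝ := 1 / ((Fintype.card w : ℝ) * Fintype.card z) with hc
  set ρ : Matrix (b × (w × z)) (b × (w × z)) ℂ :=
    (1 / ((Fintype.card w : ℂ) * (Fintype.card z : ℂ))) •
      Matrix.of fun (p q : b × (w × z)) =>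
        ∑ δ : bbar, cjOf U ((p.1, δ), p.2) ((q.1, δ), q.2) with hρdef
  have hρ (β β' : b) (j j' : w) (i i' : z) : ρ (β, (j, i)) (β', (j', i')) =
      (c : ℂ) * ((if i = i' then 1 else 0) * σ (β, j) (β', j')) := by
    rw [← hσ]
    simp [hρdef, hc]
  have hfull : ρ = Matrix.reindex (Equiv.prodAssoc b w z) (Equiv.prodAssoc b w z)
      (Matrix.blockDiagonal fun _ : z => (c : ℂ) • σ) := by
    ext ⟨β, j, i⟩ ⟨β', j', i'⟩
    rw [hρ]
    by_cases h : i = i' <;> simp [Matrix.blockDiagonal_apply, h]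
  have hBW : (Matrix.of fun (p q : b × w) => ∑ i : z, ρ (p.1, (p.2, i)) (q.1, (q.2, i))) =
      ((1 / Fintype.card w : ℝ) : ℂ) • σ := by
    ext ⟨β, j⟩ ⟨β', j'⟩
    simp only [Matrix.of_apply, hρ, if_true, Finset.sum_const, Finset.card_univ, hc,
      Matrix.smul_apply, smul_eq_mul, nsmul_eq_mul]
    push_cast
    field_simp
  have hWZ : ptrace₁ ρ = (c : ℂ) • (1 : Matrix (w × z) (w × z) ℂ) := by
    ext ⟨j, i⟩ ⟨j', i'⟩
    simp only [ptrace₁, Matrix.of_apply, hρ, ← Finset.mul_sum, hσW]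
    by_cases hi : i = i' <;> by_cases hj : j = j' <;> simp [hi, hj]
  have hW : (Matrix.of fun (j j' : w) => ∑ β : b, ∑ i : z, ρ (β, (j, i)) (β, (j', i))) =
      ((1 / Fintype.card w : ℝ) : ℂ) • (1 : Matrix w w ℂ) := by
    ext j j'
    rw [Matrix.of_apply, Finset.sum_comm]
    simp only [hρ, if_true, one_mul, ← Finset.mul_sum, hσW, Finset.sum_const, Finset.card_univ, hc,
      Matrix.smul_apply, smul_eq_mul, nsmul_eq_mul, Matrix.one_apply]
    push_cast
    field_simp
  rw [qcmiBZW, hBW, hWZ, hW, hfull, vNEntropy_blockDiagonal_const (hherm.ofReal_smul c),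
    vNEntropy_ofReal_smul hherm, vNEntropy_ofReal_smul hherm, vNEntropy_ofReal_smul_one,
    vNEntropy_ofReal_smul_one, htrace, Fintype.card_prod]
  have hcz : (Fintype.card z : ℝ) * c = 1 / Fintype.card w := by
    rw [hc]
    field_simp
  push_cast
  rw [Complex.natCast_re, ← hcz]
  ring

end
end
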